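/- arXiv:math/0307204 — 2 statements merged into one kernel-verified Lean document; each statement's English description precedes it below -/
import Mathlib

section
/- Fix an integer p ≥ 1 and t ∈ (0,1). Let u, v ∈ ℝ^p with u_i < v_i for all i. Then the probability, under the uniform distribution on (p,2n)-watermelons without wall condition, of the event { u_i·√(2n) ≤ Ŵ_i(⌊2nt⌋) ≤ v_i·√(2n) for all i = 1,…,p } converges, as n → ∞, to ∫_{[u_1,v_1]×⋯×[u_p,v_p]} f̂(t;x) dx. -/
open MeasureTheory Filter

/-- A star of length `m` without wall condition, with `p` branches, encoded as a
function `Fin p → ℕ → ℤ` (values beyond time `m` are pinned to `0` so that the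
collection of stars is a finite set). Branch `i` (0-indexed) starts at `2i`. -/
def IsStarNW (p m : ℕ) (w : Fin p → ℕ → ℤ) : Prop :=
  (∀ i : Fin p, w i 0 = 2 * ((i : ℕ) : ℤ)) ∧
  (∀ i : Fin p, ∀ k, k < m → (w i (k + 1) - w i k = 1 ∨ w i (k + 1) - w i k = -1)) ∧
  (∀ i j : Fin p, i < j → ∀ k, k ≤ m → w i k < w j k) ∧
  (∀ i : Fin p, ∀ k, m < k → w i k = 0)

/-- A `(p,2n)`-watermelon without wall condition. -/
def IsMelonNW (p n : ℕ) (w : Fin p → ℕ → ℤ) : Prop :=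
  IsStarNW p (2 * n) w ∧ ∀ i : Fin p, w i (2 * n) = 2 * ((i : ℕ) : ℤ)

/-- Probability of the event `E` under the uniform distribution on
`(p,2n)`-watermelons without wall condition. -/
noncomputable def probNW (p n : ℕ) (E : (Fin p → ℕ → ℤ) → Prop) : ℝ :=
  (Nat.card {w : Fin p → ℕ → ℤ // IsMelonNW p n w ∧ E w} : ℝ) /
    (Nat.card {w : Fin p → ℕ → ℤ // IsMelonNW p n w} : ℝ)

open Classical in
/-- The density `f̂(t;x)` of the continuous `p`-watermelon without wall condition
at time `t`. -/
noncomputable def fHat (p : ℕ) (t : ℝ) (x : Fin p → ℝ) : ℝ :=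
  if ∀ i j : Fin p, i ≤ j → x i ≤ x j then
    2 ^ (-(p : ℝ) / 2) * Real.pi ^ (-(p : ℝ) / 2) *
      (t * (1 - t)) ^ (-((p : ℝ) ^ 2 / 2)) *
      (∏ i ∈ Finset.range (p - 1), (Nat.factorial (i + 1) : ℝ))⁻¹ *
      (∏ i : Fin p, ∏ j ∈ Finset.Ioi i, (x j - x i) ^ 2) *
      Real.exp (-(∑ i, (x i) ^ 2) / (2 * t * (1 - t)))
  else 0

/-- The number of simple random walk paths of length `k` from `0` to `z`. -/
noncomputable def walkCount : ℕ → ℤ → ℝ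
  | 0, z => if z = 0 then 1 else 0
  | k + 1, z => walkCount k (z + 1) + walkCount k (z - 1)

theorem walkCount_neg (k : ℕ) (z : ℤ) : walkCount k (-z) = walkCount k z := by
  induction k generalizing z with
  | zero => simp [walkCount]
  | succ k ih =>
    simp only [walkCount]
    rw [show -z + 1 = -(z - 1) by ring, show -z - 1 = -(z + 1) by ring, ih, ih, add_comm]

theorem walkCount_of_lt (k : ℕ) (z : ℤ) (h : z < -k) : walkCount k z = 0 := by
  induction k generalizing z with
  | zero => simp only [walkCount]; rw [if_neg]; rintro rfl; simp at h
  | succ k ih =>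
    push_cast at h
    simp only [walkCount]
    rw [ih _ (by linarith), ih _ (by linarith), add_zero]

theorem walkCount_eq_choose (k a : ℕ) : walkCount k (2 * a - k) = k.choose a := by
  induction k generalizing a with
  | zero => cases a with
    | zero => simp [walkCount]
    | succ a => simp [walkCount]; omega
  | succ k ih =>
    simp only [walkCount]
    push_cast
    rw [show (2 * (a : ℤ) - (k + 1) + 1) = 2 * a - k by ring, ih]
    cases a with
    | zero => rw [walkCount_of_lt _ _ (by simp)]; simp
    | succ a =>
      push_cast
      rw [show (2 * ((a : ℤ) + 1) - (k + 1) - 1) = 2 * a - k by ring, ih, Nat.choose_succ_succ]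
      push_cast; ring

/-- The Karlin–McGregor determinant for `k` steps from `y` to `c`. -/
noncomputable def walkDet {p : ℕ} (k : ℕ) (c y : Fin p → ℤ) : ℝ :=
  (Matrix.of fun j i => walkCount k (y j - c i)).det

theorem walkDet_comm {p : ℕ} (k : ℕ) (c y : Fin p → ℤ) : walkDet k c y = walkDet k y c := by
  unfold walkDet
  rw [← Matrix.det_transpose]
  congr 1
  ext i j
  simp only [Matrix.transpose_apply, Matrix.of_apply]
  rw [← walkCount_neg, neg_sub]

theorem walkDet_zero {p : ℕ} {c y : Fin p → ℤ} (hc : StrictMono c) (hy : StrictMono y) :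
    walkDet 0 c y = if y = c then 1 else 0 := by
  unfold walkDet
  split_ifs with h
  · subst h
    convert Matrix.det_one (n := Fin p) (R := ℝ) using 2
    ext i j
    simp [walkCount, Matrix.one_apply, sub_eq_zero, hy.injective.eq_iff]
  · obtain ⟨j, hj⟩ : ∃ j, ∀ i, y j ≠ c i := by
      by_contra! hcon
      apply h
      refine (StrictMono.range_inj hy hc).1 ?_
      have hsub : Finset.univ.image y ⊆ Finset.univ.image c := by
        intro z hz
        obtain ⟨j, -, rfl⟩ := Finset.mem_image.1 hz
        obtain ⟨i, hi⟩ := hcon j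
        exact Finset.mem_image.2 ⟨i, Finset.mem_univ _, hi.symm⟩
      have := Finset.eq_of_subset_of_card_le hsub (by
        rw [Finset.card_image_of_injective _ hy.injective,
          Finset.card_image_of_injective _ hc.injective])
      simpa using congrArg (fun s : Finset ℤ => (s : Set ℤ)) this
    apply Matrix.det_eq_zero_of_row_eq_zero j
    intro i
    simp [walkCount, sub_eq_zero, hj i]

/-- The increment `+1` on `T` and `-1` off `T`. -/
def signStep {p : ℕ} (T : Finset (Fin p)) (i : Fin p) : ℤ := if i ∈ T then 1 else -1

theorem walkDet_succ {p : ℕ} (k : ℕ) (c y : Fin p → ℤ) :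
    walkDet (k + 1) c y = ∑ T : Finset (Fin p), walkDet k c (fun i => y i + signStep T i) := by
  unfold walkDet
  have h := (Matrix.detRowAlternating (R := ℝ) (n := Fin p)).toMultilinearMap.map_add_univ
    (fun j i => walkCount k (y j + 1 - c i)) (fun j i => walkCount k (y j - 1 - c i))
  have h1 : (Matrix.of fun j i => walkCount (k + 1) (y j - c i)) =
      (fun j i => walkCount k (y j + 1 - c i)) + (fun j i => walkCount k (y j - 1 - c i)) := by
    ext j i
    simp only [Matrix.of_apply, walkCount, Pi.add_apply]
    congr 2 <;> ring
  rw [h1]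
  refine h.trans (Finset.sum_congr rfl fun T _ => ?_)
  change Matrix.det _ = _
  congr 1
  ext j i
  by_cases hj : j ∈ T <;> simp [Finset.piecewise, hj, signStep, sub_eq_add_neg]

theorem walkDet_eq_zero_of_not_strictMono {p : ℕ} (k : ℕ) (c y : Fin p → ℤ)
    (hy : StrictMono y) (hpar : ∀ i j, Even (y i - y j)) (T : Finset (Fin p))
    (hT : ¬ StrictMono fun i => y i + signStep T i) :
    walkDet k c (fun i => y i + signStep T i) = 0 := by
  simp only [StrictMono, not_forall, not_lt] at hT
  obtain ⟨i, j, hij, hle⟩ := hT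
  have h1 := hy hij
  obtain ⟨z, hz⟩ := hpar i j
  have h2 : y i + signStep T i = y j + signStep T j := by
    unfold signStep at hle ⊢
    split_ifs at hle ⊢ <;> omega
  apply Matrix.det_zero_of_row_eq hij.ne
  ext l
  simp [h2]

/-- Extension of a star by one step at time `k + 1`. -/
def extendStar {p : ℕ} (k : ℕ) (w : Fin p → ℕ → ℤ) (T : Finset (Fin p)) : Fin p → ℕ → ℤ :=
  fun i j => if j = k + 1 then w i k + signStep T i else w i j

open Classical in
/-- The finite set of stars of length `k`. -/
noncomputable def starFinset (p : ℕ) : ℕ → Finset (Fin p → ℕ → ℤ)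
  | 0 => {fun (i : Fin p) (j : ℕ) => (if j = 0 then 2 * ((i : ℕ) : ℤ) else 0 : ℤ)}
  | k + 1 => ((starFinset p k ×ˢ Finset.univ).filter
      (fun q => StrictMono fun i => q.1 i k + signStep q.2 i)).image
        fun q => extendStar k q.1 q.2

theorem mem_starFinset {p k : ℕ} {w : Fin p → ℕ → ℤ} : w ∈ starFinset p k ↔ IsStarNW p k w := by
  classical
  induction k generalizing w with
  | zero =>
    simp only [starFinset, Finset.mem_singleton, IsStarNW]
    constructor
    · rintro rfl
      refine ⟨by simp, by simp, ?_, ?_⟩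
      · intro i j hij k hk
        have : (i : ℕ) < j := hij
        simp only [Nat.le_zero.1 hk, if_true]; omega
      · intro i k hk
        simp [hk.ne']
    · rintro ⟨h0, -, -, h3⟩
      ext i j
      split_ifs with hj
      · rw [hj, h0]
      · exact h3 i j (Nat.pos_of_ne_zero hj)
  | succ k ih =>
    simp only [starFinset, Finset.mem_image, Finset.mem_filter, Finset.mem_product, ih,
      Finset.mem_univ, and_true, Prod.exists]
    constructor
    · rintro ⟨w, T, ⟨⟨h0, h1, h2, h3⟩, hT⟩, rfl⟩
      refine ⟨?_, ?_, ?_, ?_⟩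
      · intro i; simp [extendStar, h0]
      · intro i j hj
        unfold extendStar
        rw [if_neg hj.ne]
        by_cases hjk : j = k
        · subst hjk
          rw [if_pos rfl]; unfold signStep; split_ifs <;> simp
        · rw [if_neg (by omega)]
          exact h1 i j (by omega)
      · intro i j hij l hl
        unfold extendStar
        split_ifs with h
        · exact hT hij
        · exact h2 i j hij l (by omega)
      · intro i j hj
        unfold extendStar
        rw [if_neg hj.ne']
        exact h3 i j (by omega)
    · rintro ⟨h0, h1, h2, h3⟩
      have key : ∀ i, w i k + signStep (Finset.univ.filter fun i => w i (k + 1) - w i k = 1) i =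
          w i (k + 1) := by
        intro i
        have := h1 i k (by omega)
        simp only [signStep, Finset.mem_filter, Finset.mem_univ, true_and]
        split_ifs <;> omega
      refine ⟨fun i j => if j = k + 1 then 0 else w i j,
        Finset.univ.filter (fun i => w i (k + 1) - w i k = 1), ⟨⟨?_, ?_, ?_, ?_⟩, ?_⟩, ?_⟩
      · intro i; simp [h0]
      · intro i j hj
        dsimp only
        rw [if_neg (by omega), if_neg (by omega)]
        exact h1 i j (by omega)
      · intro i j hij l hl
        dsimp only
        rw [if_neg (by omega), if_neg (by omega)]
        exact h2 i j hij l (by omega)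
      · intro i j hj
        dsimp only
        split_ifs
        · rfl
        · exact h3 i j (by omega)
      · intro i j hij
        dsimp only
        rw [if_neg (by omega), if_neg (by omega), key, key]
        exact h2 i j hij _ le_rfl
      · ext i j
        unfold extendStar
        dsimp only
        rw [if_neg (by omega : ¬ k = k + 1), key]
        split_ifs with h
        · rw [h]
        · rfl

open Classical in
theorem sum_starFinset_succ {p : ℕ} (k : ℕ) (F : (Fin p → ℕ → ℤ) → ℝ) :
    ∑ w ∈ starFinset p (k + 1), F w = ∑ w ∈ starFinset p k, ∑ T : Finset (Fin p),
      if StrictMono (fun i => w i k + signStep T i) then F (extendStar k w T) else 0 := by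
  rw [starFinset, Finset.sum_image, Finset.sum_filter, Finset.sum_product]
  rintro ⟨w, T⟩ hw ⟨w', T'⟩ hw' h
  simp only [Finset.coe_filter, Finset.mem_product, mem_starFinset, Finset.mem_univ, and_true,
    Set.mem_ofPred_eq] at hw hw' h
  have hww : w = w' := by
    ext i j
    by_cases hj : j = k + 1
    · rw [hw.1.2.2.2 i j (by omega), hw'.1.2.2.2 i j (by omega)]
    · simpa [extendStar, hj] using congrFun (congrFun h i) j
  subst hww
  refine Prod.ext rfl ?_
  ext i
  have := congrFun (congrFun h i) (k + 1)
  simp only [extendStar, if_true, add_right_inj, signStep] at this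
  split_ifs at this <;> simp_all

theorem IsStarNW.even_add {p m : ℕ} {w : Fin p → ℕ → ℤ} (h : IsStarNW p m w) (i : Fin p)
    {k : ℕ} (hk : k ≤ m) : Even (w i k + k) := by
  induction k with
  | zero => simp [h.1]
  | succ k ih =>
    obtain ⟨z, hz⟩ := ih (by omega)
    rcases h.2.1 i k (by omega) with h' | h'
    · exact ⟨z + 1, by push_cast; omega⟩
    · exact ⟨z, by push_cast; omega⟩

open Classical in
theorem sum_starFinset_transfer {p : ℕ} {c : Fin p → ℤ} (hc : StrictMono c)
    (h : (Fin p → ℤ) → ℝ) (r m k : ℕ) (hm : m ≤ k) :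
    (∑ w ∈ starFinset p (k + r), if (fun i => w i (k + r)) = c then h (fun i => w i m) else 0) =
      ∑ w ∈ starFinset p k, h (fun i => w i m) * walkDet r c (fun i => w i k) := by
  induction r generalizing k with
  | zero =>
    refine Finset.sum_congr rfl fun w hw => ?_
    rw [walkDet_zero hc (fun i j hij => (mem_starFinset.1 hw).2.2.1 i j hij k le_rfl)]
    simp
  | succ r ih =>
    rw [show k + (r + 1) = k + 1 + r by ring, ih (k + 1) (by omega), sum_starFinset_succ]
    refine Finset.sum_congr rfl fun w hw => ?_
    rw [walkDet_succ, Finset.mul_sum]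
    refine Finset.sum_congr rfl fun T _ => ?_
    have hs := mem_starFinset.1 hw
    split_ifs with hT
    · simp [extendStar, show m ≠ k + 1 by omega]
    · rw [walkDet_eq_zero_of_not_strictMono r c _ (fun i j hij => hs.2.2.1 i j hij k le_rfl) ?_ T
        hT, mul_zero]
      intro i j
      have := (hs.even_add i le_rfl).sub (hs.even_add j le_rfl)
      simpa using this

theorem starFinset_zero_sum {p : ℕ} (F : (Fin p → ℤ) → ℝ) :
    ∑ w ∈ starFinset p 0, F (fun i => w i 0) = F fun i => 2 * ((i : ℕ) : ℤ) := by
  simp [starFinset]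

theorem strictMono_two_mul (p : ℕ) : StrictMono fun i : Fin p => 2 * ((i : ℕ) : ℤ) := by
  intro i j hij
  have : (i : ℕ) < j := hij
  dsimp only
  omega

/-- The number of melons is a Karlin–McGregor determinant. -/
theorem card_isMelonNW (p n : ℕ) : (Nat.card {w : Fin p → ℕ → ℤ // IsMelonNW p n w} : ℝ) =
    walkDet (2 * n) (fun i : Fin p => 2 * ((i : ℕ) : ℤ)) (fun i => 2 * ((i : ℕ) : ℤ)) := by
  classical
  have h := sum_starFinset_transfer (strictMono_two_mul p) (fun _ => 1) (2 * n) 0 0 le_rfl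
  rw [starFinset_zero_sum (fun y => 1 * walkDet (2 * n) _ y), one_mul] at h
  rw [← h, Nat.card_congr (Equiv.subtypeEquivRight
    (q := fun w => w ∈ (starFinset p (0 + 2 * n)).filter
    fun w => (fun i => w i (0 + 2 * n)) = fun i : Fin p => 2 * ((i : ℕ) : ℤ)) ?_),
    Nat.card_eq_fintype_card, Fintype.card_coe, ← Finset.sum_filter, Finset.sum_const, nsmul_one]
  intro w
  simp [mem_starFinset, IsMelonNW, funext_iff]

open Classical in
theorem card_isMelonNW_event (p n m : ℕ) (hm : m ≤ 2 * n) (S : Finset (Fin p → ℤ)) :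
    (Nat.card {w : Fin p → ℕ → ℤ // IsMelonNW p n w ∧
      ∃ a ∈ S, ∀ i, w i m = 2 * a i - m} : ℝ) =
    ∑ a ∈ S, if StrictMono a then
      walkDet m (fun i : Fin p => 2 * ((i : ℕ) : ℤ)) (fun i => 2 * a i - m) *
      walkDet (2 * n - m) (fun i : Fin p => 2 * ((i : ℕ) : ℤ)) (fun i => 2 * a i - m) else 0 := by
  have hN : m + (2 * n - m) = 2 * n := by omega
  set s : Fin p → ℤ := fun i : Fin p => 2 * ((i : ℕ) : ℤ) with hs
  have h := sum_starFinset_transfer (strictMono_two_mul p)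
    (fun y => if ∃ a ∈ S, ∀ i, y i = 2 * a i - m then 1 else 0) (2 * n - m) m m le_rfl
  rw [hN] at h
  have h1 : (Nat.card {w : Fin p → ℕ → ℤ // IsMelonNW p n w ∧
      ∃ a ∈ S, ∀ i, w i m = 2 * a i - m} : ℝ) =
      ∑ w ∈ starFinset p (2 * n), if (fun i => w i (2 * n)) = s then
        (if ∃ a ∈ S, ∀ i, w i m = 2 * a i - m then 1 else 0) else 0 := by
    rw [Nat.card_congr (Equiv.subtypeEquivRight (q := fun w => w ∈ (starFinset p (2 * n)).filter
      fun w => (fun i => w i (2 * n)) = s ∧ ∃ a ∈ S, ∀ i, w i m = 2 * a i - m) ?_),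
      Nat.card_eq_fintype_card, Fintype.card_coe]
    · rw [Finset.sum_congr rfl fun w _ => (ite_and _ _ _ _).symm, ← Finset.sum_filter,
        Finset.sum_const, nsmul_one]
    · intro w
      simp [mem_starFinset, IsMelonNW, funext_iff, hs, and_assoc]
  rw [h1, h]
  have h2 : ∀ w : Fin p → ℕ → ℤ, (if ∃ a ∈ S, ∀ i, w i m = 2 * a i - m then (1 : ℝ) else 0) *
      walkDet (2 * n - m) s (fun i => w i m) = ∑ a ∈ S,
      if (fun i => w i m) = (fun i => 2 * a i - (m : ℤ)) then
        walkDet (2 * n - m) s (fun i => 2 * a i - m) else 0 := by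
    intro w
    split_ifs with hw
    · obtain ⟨a, ha, haw⟩ := hw
      rw [Finset.sum_eq_single_of_mem a ha]
      · rw [if_pos (funext haw), one_mul, funext haw]
      · intro b _ hb
        rw [if_neg]
        intro hcon
        apply hb
        ext i
        have := congrFun hcon i
        simp only [haw] at this
        omega
    · rw [zero_mul, Finset.sum_eq_zero]
      intro a ha
      rw [if_neg]
      intro hcon
      exact hw ⟨a, ha, congrFun hcon⟩
  rw [Finset.sum_congr rfl fun w _ => h2 w, Finset.sum_comm]
  refine Finset.sum_congr rfl fun a _ => ?_
  have hiff : StrictMono (fun i => 2 * a i - (m : ℤ)) ↔ StrictMono a := by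
    constructor
    · intro h i j hij
      have := h hij
      dsimp only at this
      omega
    · intro h i j hij
      have := h hij
      dsimp only
      omega
  split_ifs with ha
  · have h3 := sum_starFinset_transfer (hiff.2 ha)
      (fun _ => walkDet (2 * n - m) s (fun i => 2 * a i - (m : ℤ))) m 0 0 le_rfl
    rw [starFinset_zero_sum (fun y => _ * walkDet m _ y), walkDet_comm m, zero_add] at h3
    exact h3.trans (mul_comm _ _)
  · refine Finset.sum_eq_zero fun w hw => if_neg fun hcon => ha (hiff.1 ?_)
    rw [← hcon]
    exact fun i j hij => (mem_starFinset.1 hw).2.2.1 i j hij m le_rfl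

open Polynomial in
theorem det_eval_eq_det_coeff_mul {p : ℕ} (P : Fin p → ℝ[X]) (hP : ∀ i, (P i).natDegree < p)
    (v : Fin p → ℝ) : (Matrix.of fun j i => (P i).eval (v j)).det =
      (Matrix.vandermonde v).det * (Matrix.of fun (k : Fin p) i => (P i).coeff k).det := by
  rw [← Matrix.det_mul]
  congr 1
  ext j i
  simp only [Matrix.of_apply, Matrix.mul_apply, Matrix.vandermonde_apply]
  rw [Polynomial.eval_eq_sum_range' (hP i), Finset.sum_range]
  exact Finset.sum_congr rfl fun k _ => mul_comm _ _

theorem det_vandermonde_id_real (p : ℕ) :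
    (Matrix.vandermonde fun i : Fin p => ((i : ℕ) : ℝ)).det =
      ∏ i : Fin p, ((i : ℕ).factorial : ℝ) := by
  cases p with
  | zero => simp
  | succ p =>
    rw [Matrix.det_vandermonde_id_eq_superFactorial, ← Nat.prod_range_succ_factorial,
      Finset.prod_range]
    push_cast
    rfl

open Polynomial in
theorem det_descFactorial_mul (p m : ℕ) (b : Fin p → ℕ) (hb : ∀ j, b j ≤ m) :
    (Matrix.of fun j i : Fin p => ((b j).descFactorial i : ℝ) *
      ((m + (p - 1) - b j).descFactorial (p - 1 - i) : ℝ)).det =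
    (∏ i : Fin p, ((m + i).factorial / m.factorial : ℝ)) *
      ∏ i : Fin p, ∏ j ∈ Finset.Ioi i, ((b j : ℝ) - b i) := by
  set P : Fin p → ℝ[X] := fun i =>
    descPochhammer ℝ i * (descPochhammer ℝ (p - 1 - i)).comp (C ((m + (p - 1) : ℕ) : ℝ) - X) with hP
  have hdeg : ∀ i, (P i).natDegree < p := by
    intro i
    have h1 : (C ((m + (p - 1) : ℕ) : ℝ) - X).natDegree ≤ 1 := by
      refine (natDegree_sub_le _ _).trans ?_
      rw [natDegree_C, natDegree_X]
      simp
    have h2 : (P i).natDegree ≤ i + (p - 1 - i) * 1 := by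
      refine natDegree_mul_le.trans ?_
      rw [descPochhammer_natDegree]
      gcongr
      refine natDegree_comp_le.trans ?_
      rw [descPochhammer_natDegree]
      gcongr
    have := i.2
    omega
  have heval : ∀ (i : Fin p) (x : ℕ), x ≤ m + (p - 1) → (P i).eval (x : ℝ) =
      (x.descFactorial i : ℝ) * ((m + (p - 1) - x).descFactorial (p - 1 - i) : ℝ) := by
    intro i x hx
    rw [hP]
    simp only [eval_mul, eval_comp, eval_sub, eval_C, eval_X]
    rw [← Nat.cast_sub hx, descPochhammer_eval_eq_descFactorial,
      descPochhammer_eval_eq_descFactorial]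
  have h0 := det_eval_eq_det_coeff_mul P hdeg (fun i : Fin p => ((i : ℕ) : ℝ))
  have h1 := det_eval_eq_det_coeff_mul P hdeg (fun j => (b j : ℝ))
  have h2 : (Matrix.of fun j i => (P i).eval (b j : ℝ)) = Matrix.of fun j i : Fin p =>
      ((b j).descFactorial i : ℝ) * ((m + (p - 1) - b j).descFactorial (p - 1 - i) : ℝ) := by
    ext j i
    exact heval i (b j) (by have := hb j; omega)
  have h3 : (Matrix.of fun j i : Fin p => (P i).eval ((j : ℕ) : ℝ)).det =
      (∏ j : Fin p, ((j : ℕ).factorial : ℝ)) *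
        ∏ i : Fin p, ((m + i).factorial / m.factorial : ℝ) := by
    rw [Matrix.det_of_isLowerTriangular]
    · rw [← Equiv.prod_comp Fin.revPerm (fun i : Fin p => ((m + i).factorial / m.factorial : ℝ)),
        ← Finset.prod_mul_distrib]
      refine Finset.prod_congr rfl fun j _ => ?_
      have hj := j.2
      rw [Matrix.of_apply, heval _ _ (by omega), Nat.descFactorial_self]
      congr 1
      rw [eq_div_iff (by positivity), ← Nat.cast_mul, mul_comm]
      have := Nat.factorial_mul_descFactorial (n := m + (p - 1) - j) (k := p - 1 - j) (by omega)
      rw [show m + (p - 1) - (j : ℕ) - (p - 1 - j) = m by omega] at this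
      rw [this]
      congr 2
      simp [Fin.val_rev]
      omega
    · intro j i hij
      have hij' : (j : ℕ) < i := hij
      rw [Matrix.of_apply, heval _ _ (by omega),
        Nat.descFactorial_eq_zero_iff_lt.2 hij']
      simp
  rw [h2] at h1
  rw [h3, det_vandermonde_id_real] at h0
  have h4 : (∏ j : Fin p, ((j : ℕ).factorial : ℝ)) ≠ 0 := by positivity
  rw [h1, ← mul_left_cancel₀ h4 h0, Matrix.det_vandermonde, mul_comm]

/-- The one-particle weight in the product formula for the number of stars. -/
noncomputable def starWeight (q i m b : ℕ) : ℝ :=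
  (m + i).factorial / (b.factorial * (m + q - b).factorial)

theorem starWeight_pos (q i m b : ℕ) : 0 < starWeight q i m b := by
  unfold starWeight; positivity

/-- The product formula for the number of stars with prescribed end points. -/
theorem walkDet_eq_prod {p m : ℕ} (b : Fin p → ℕ) (hb : ∀ j, b j ≤ m) :
    walkDet m (fun i : Fin p => 2 * ((i : ℕ) : ℤ)) (fun j => 2 * (b j : ℤ) - m) =
      (∏ i : Fin p, starWeight (p - 1) i m (b i)) *
        ∏ i : Fin p, ∏ j ∈ Finset.Ioi i, ((b j : ℝ) - b i) := by
  have hentry : (Matrix.of fun j i : Fin p => walkCount m (2 * (b j : ℤ) - m - 2 * ((i : ℕ) : ℤ))) =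
      Matrix.of fun j i : Fin p => (m.factorial / ((b j).factorial *
        (m + (p - 1) - b j).factorial) : ℝ) * (Matrix.of fun j i : Fin p =>
        ((b j).descFactorial i : ℝ) * ((m + (p - 1) - b j).descFactorial (p - 1 - i) : ℝ)) j i := by
    ext j i
    simp only [Matrix.of_apply]
    have hi := i.2
    have hbj := hb j
    rcases lt_or_ge (b j) i with h | h
    · rw [walkCount_of_lt _ _ (by omega), Nat.descFactorial_eq_zero_iff_lt.2 h]
      simp
    · rw [show 2 * (b j : ℤ) - m - 2 * ((i : ℕ) : ℤ) = 2 * ((b j - i : ℕ) : ℤ) - m by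
        push_cast [h]; ring, walkCount_eq_choose, Nat.cast_choose ℝ (by omega)]
      rw [← Nat.factorial_mul_descFactorial h,
        ← Nat.factorial_mul_descFactorial (n := m + (p - 1) - b j) (k := p - 1 - i) (by omega),
        show m + (p - 1) - b j - (p - 1 - i) = m - (b j - i) by omega]
      have h1 : ((b j).descFactorial i : ℝ) ≠ 0 := by
        exact_mod_cast fun h' => absurd (Nat.descFactorial_eq_zero_iff_lt.1 h') (by omega)
      have h2 : ((m + (p - 1) - b j).descFactorial (p - 1 - i) : ℝ) ≠ 0 := by
        exact_mod_cast fun h' => absurd (Nat.descFactorial_eq_zero_iff_lt.1 h') (by omega)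
      push_cast
      field_simp
  rw [walkDet, hentry, Matrix.det_mul_column, det_descFactorial_mul p m b hb, ← mul_assoc,
    ← Finset.prod_mul_distrib]
  congr 1
  refine Finset.prod_congr rfl fun i _ => ?_
  unfold starWeight
  field_simp

open Topology

theorem abs_entropy_sub_sq_le {x : ℝ} (hx : |x| ≤ 1 / 2) :
    |(1 + x) * Real.log (1 + x) + (1 - x) * Real.log (1 - x) - x ^ 2| ≤ 6 * |x| ^ 3 := by
  have key : ∀ y : ℝ, |y| ≤ 1 / 2 → |y + y ^ 2 / 2 + Real.log (1 - y)| ≤ 2 * |y| ^ 3 := by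
    intro y hy
    have h := Real.abs_log_sub_add_sum_range_le (x := y) (by linarith) 2
    simp only [Finset.sum_range_succ, Finset.sum_range_zero] at h
    norm_num at h
    refine h.trans ?_
    rw [div_le_iff₀ (by linarith)]
    have : 0 ≤ |y| ^ 3 := by positivity
    nlinarith
  have h1 := key x hx
  have h2 := key (-x) (by rwa [abs_neg])
  rw [abs_neg, sub_neg_eq_add] at h2
  obtain ⟨hx1, hx2⟩ := abs_le.1 hx
  have e : (1 + x) * Real.log (1 + x) + (1 - x) * Real.log (1 - x) - x ^ 2 =
      (1 + x) * (-x + (-x) ^ 2 / 2 + Real.log (1 + x)) +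
        (1 - x) * (x + x ^ 2 / 2 + Real.log (1 - x)) := by ring
  rw [e]
  refine (abs_add_le _ _).trans ?_
  rw [abs_mul, abs_mul, abs_of_nonneg (by linarith : 0 ≤ 1 + x),
    abs_of_nonneg (by linarith : 0 ≤ 1 - x)]
  nlinarith [abs_nonneg (-x + (-x) ^ 2 / 2 + Real.log (1 + x)),
    abs_nonneg (x + x ^ 2 / 2 + Real.log (1 - x))]

section LocalLimit

variable {α : Type*} {l : Filter α} {m b : α → ℕ} {y : ℝ}

theorem tendsto_sqrt_natCast_atTop (hm : Tendsto m l atTop) :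
    Tendsto (fun a => √(m a : ℝ)) l atTop :=
  Real.tendsto_sqrt_atTop.comp (tendsto_natCast_atTop_atTop.comp hm)

theorem tendsto_natCast_div_half (hm : Tendsto m l atTop)
    (hb : Tendsto (fun a => (2 * (b a : ℝ) - m a) / √(m a)) l (𝓝 y)) :
    Tendsto (fun a => (b a : ℝ) / m a) l (𝓝 (1 / 2)) := by
  have h1 : Tendsto (fun a => 1 / 2 + ((2 * (b a : ℝ) - m a) / √(m a)) / √(m a) / 2) l
      (𝓝 (1 / 2 + 0 / 2)) :=
    ((hb.div_atTop (tendsto_sqrt_natCast_atTop hm)).div_const 2).const_add _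
  rw [zero_div, add_zero] at h1
  refine h1.congr' ?_
  filter_upwards [hm.eventually_gt_atTop 0] with a ha
  have : (0 : ℝ) < m a := by exact_mod_cast ha
  rw [div_div _ (√_) (√_), Real.mul_self_sqrt this.le]
  field_simp
  ring

theorem tendsto_atTop_of_div_half (hm : Tendsto m l atTop)
    (hb : Tendsto (fun a => (b a : ℝ) / m a) l (𝓝 (1 / 2))) : Tendsto b l atTop := by
  rw [← tendsto_natCast_atTop_iff (R := ℝ)]
  have h1 := hb.pos_mul_atTop (by norm_num) (tendsto_natCast_atTop_atTop (R := ℝ) |>.comp hm)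
  refine h1.congr' ?_
  filter_upwards [hm.eventually_gt_atTop 0] with a ha
  have : (0 : ℝ) < m a := by exact_mod_cast ha
  simp only [Function.comp]
  field_simp

theorem eventually_lt_of_div_half (hm : Tendsto m l atTop)
    (hb : Tendsto (fun a => (b a : ℝ) / m a) l (𝓝 (1 / 2))) : ∀ᶠ a in l, b a < m a := by
  filter_upwards [hm.eventually_gt_atTop 0, hb.eventually_lt_const (by norm_num : (1 / 2 : ℝ) < 1)]
    with a ha h
  have : (0 : ℝ) < m a := by exact_mod_cast ha
  rw [div_lt_one this] at h
  exact_mod_cast h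

theorem tendsto_sub_div_half (hm : Tendsto m l atTop)
    (hb : Tendsto (fun a => (b a : ℝ) / m a) l (𝓝 (1 / 2))) :
    Tendsto (fun a => ((m a - b a : ℕ) : ℝ) / m a) l (𝓝 (1 / 2)) := by
  have h := hb.const_sub 1
  rw [show (1 : ℝ) - 1 / 2 = 1 / 2 by norm_num] at h
  refine h.congr' ?_
  filter_upwards [hm.eventually_gt_atTop 0, eventually_lt_of_div_half hm hb] with a ha hab
  have : (0 : ℝ) < m a := by exact_mod_cast ha
  rw [Nat.cast_sub hab.le]
  field_simp

theorem tendsto_entropy (hm : Tendsto m l atTop)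
    (hb : Tendsto (fun a => (2 * (b a : ℝ) - m a) / √(m a)) l (𝓝 y)) :
    Tendsto (fun a => ((m a : ℝ) / 2) ^ m a / ((b a : ℝ) ^ b a *
      ((m a - b a : ℕ) : ℝ) ^ (m a - b a))) l (𝓝 (Real.exp (-y ^ 2 / 2))) := by
  set z : α → ℝ := fun a => (2 * (b a : ℝ) - m a) / √(m a) with hz
  set d : α → ℝ := fun a => z a / √(m a) with hd
  have hd0 : Tendsto d l (𝓝 0) := hb.div_atTop (tendsto_sqrt_natCast_atTop hm)
  have hhalf := tendsto_natCast_div_half hm hb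
  set f : ℝ → ℝ := fun x => (1 + x) * Real.log (1 + x) + (1 - x) * Real.log (1 - x)
  have herr : Tendsto (fun a => (m a : ℝ) / 2 * (f (d a) - d a ^ 2)) l (𝓝 0) := by
    have hbd : Tendsto (fun a => 3 * z a ^ 2 * |d a|) l (𝓝 (3 * y ^ 2 * |0|)) :=
      ((hb.pow 2).const_mul 3).mul hd0.abs
    rw [abs_zero, mul_zero] at hbd
    refine squeeze_zero_norm' ?_ hbd
    filter_upwards [hm.eventually_gt_atTop 0,
      hd0.abs.eventually_le_const (by norm_num : |(0 : ℝ)| < 1 / 2)] with a ha hda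
    have hma : (0 : ℝ) < m a := by exact_mod_cast ha
    have h1 := abs_entropy_sub_sq_le hda
    have h2 : (m a : ℝ) * |d a| ^ 2 = z a ^ 2 := by
      rw [sq_abs, hd, div_pow, Real.sq_sqrt hma.le]
      field_simp
    rw [Real.norm_eq_abs, abs_mul, abs_of_pos (by positivity : 0 < (m a : ℝ) / 2)]
    calc (m a : ℝ) / 2 * |f (d a) - d a ^ 2| ≤ (m a : ℝ) / 2 * (6 * |d a| ^ 3) := by gcongr
      _ = 3 * ((m a : ℝ) * |d a| ^ 2) * |d a| := by ring
      _ = _ := by rw [h2]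
  have hmain : Tendsto (fun a => -(z a ^ 2 / 2 + (m a : ℝ) / 2 * (f (d a) - d a ^ 2))) l
      (𝓝 (-(y ^ 2 / 2 + 0))) := (((hb.pow 2).div_const 2).add herr).neg
  rw [show -(y ^ 2 / 2 + 0) = -y ^ 2 / 2 by ring] at hmain
  refine ((Real.continuous_exp.tendsto _).comp hmain).congr' ?_
  filter_upwards [hm.eventually_gt_atTop 0, eventually_lt_of_div_half hm hhalf,
    (tendsto_atTop_of_div_half hm hhalf).eventually_gt_atTop 0] with a ha hlt hb0
  have hma : (0 : ℝ) < m a := by exact_mod_cast ha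
  have hba : (0 : ℝ) < b a := by exact_mod_cast hb0
  have hca : (0 : ℝ) < ((m a - b a : ℕ) : ℝ) := by exact_mod_cast (by omega : 0 < m a - b a)
  have hc : ((m a - b a : ℕ) : ℝ) = m a - b a := by rw [Nat.cast_sub hlt.le]
  have hda : d a = (2 * (b a : ℝ) - m a) / m a := by
    rw [hd, hz]; dsimp only; rw [div_div, Real.mul_self_sqrt hma.le]
  have h2 : (m a : ℝ) * d a ^ 2 = z a ^ 2 := by
    rw [hd, div_pow, Real.sq_sqrt hma.le]
    field_simp
  have e1 : 1 + d a = b a / (m a / 2) := by rw [hda]; field_simp; ring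
  have e2 : 1 - d a = ((m a - b a : ℕ) : ℝ) / (m a / 2) := by rw [hda, hc]; field_simp; ring
  have e3 : -(z a ^ 2 / 2 + (m a : ℝ) / 2 * (f (d a) - d a ^ 2)) =
      (m a : ℝ) * Real.log (m a / 2) - (b a * Real.log (b a) +
        ((m a - b a : ℕ) : ℝ) * Real.log ((m a - b a : ℕ) : ℝ)) := by
    rw [← h2]
    simp only [f]
    rw [e1, e2, Real.log_div hba.ne' (by positivity), Real.log_div hca.ne' (by positivity), hc]
    field_simp
    ring
  simp only [Function.comp]
  rw [e3, Real.exp_sub, Real.exp_add, mul_comm, mul_comm (b a : ℝ), mul_comm ((m a - b a : ℕ) : ℝ)]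
  rw [← Real.rpow_def_of_pos (by positivity), ← Real.rpow_def_of_pos hba,
    ← Real.rpow_def_of_pos hca, Real.rpow_natCast, Real.rpow_natCast, Real.rpow_natCast]

theorem tendsto_choose_local (hm : Tendsto m l atTop)
    (hb : Tendsto (fun a => (2 * (b a : ℝ) - m a) / √(m a)) l (𝓝 y)) :
    Tendsto (fun a => ((m a).choose (b a) : ℝ) / 2 ^ m a * √(m a)) l
      (𝓝 (√2 / √Real.pi * Real.exp (-y ^ 2 / 2))) := by
  have hhalf := tendsto_natCast_div_half hm hb
  have hhalf' := tendsto_sub_div_half hm hhalf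
  have hbt := tendsto_atTop_of_div_half hm hhalf
  have hct := tendsto_atTop_of_div_half hm hhalf'
  have hpi : √Real.pi ≠ 0 := by positivity
  have hst := Stirling.tendsto_stirlingSeq_sqrt_pi
  have h1 := ((hst.comp hm).div ((hst.comp hbt).mul (hst.comp hct)) (by positivity)).mul
    (tendsto_entropy hm hb)
  have h2 : Tendsto (fun a => 1 / √2 / (√((b a : ℝ) / m a) * √(((m a - b a : ℕ) : ℝ) / m a))) l
      (𝓝 (1 / √2 / (√(1 / 2) * √(1 / 2)))) :=
    tendsto_const_nhds.div (hhalf.sqrt.mul hhalf'.sqrt) (by positivity)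
  have h3 := h1.mul h2
  have e : √Real.pi / (√Real.pi * √Real.pi) * Real.exp (-y ^ 2 / 2) *
      (1 / √2 / (√(1 / 2) * √(1 / 2))) = √2 / √Real.pi * Real.exp (-y ^ 2 / 2) := by
    have : √2 * √2 = (2 : ℝ) := Real.mul_self_sqrt (by norm_num)
    rw [Real.mul_self_sqrt (by norm_num : (0 : ℝ) ≤ 1 / 2)]
    field_simp
    nlinarith
  rw [e] at h3
  refine h3.congr' ?_
  filter_upwards [hm.eventually_gt_atTop 0, eventually_lt_of_div_half hm hhalf,
    hbt.eventually_gt_atTop 0] with a ha hlt hb0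
  obtain ⟨c, hc⟩ : ∃ c, c = m a - b a := ⟨_, rfl⟩
  have hbc : m a = b a + c := by omega
  simp only [Function.comp, Pi.div_apply]
  rw [Nat.cast_choose ℝ hlt.le, ← hc]
  have hma : (0 : ℝ) < m a := by exact_mod_cast ha
  have hba : (0 : ℝ) < b a := by exact_mod_cast hb0
  have hca : (0 : ℝ) < c := by exact_mod_cast (by omega : 0 < c)
  have hf : ∀ n : ℕ, 0 < (n : ℝ) → (n.factorial : ℝ) =
      Stirling.stirlingSeq n * (√2 * √n * ((n : ℝ) ^ n / Real.exp 1 ^ n)) := by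
    intro n hn
    rw [Stirling.stirlingSeq, Real.sqrt_mul (by norm_num), div_pow, div_mul_cancel₀]
    positivity
  have hs : ∀ n : ℕ, 0 < (n : ℝ) → Stirling.stirlingSeq n ≠ 0 := by
    intro n hn
    have := Nat.exists_eq_succ_of_ne_zero (n := n) (by rintro rfl; simp at hn)
    obtain ⟨k, rfl⟩ := this
    exact (Stirling.stirlingSeq'_pos k).ne'
  rw [hf _ hma, hf _ hba, hf _ hca, Real.sqrt_div' _ hma.le, Real.sqrt_div' _ hma.le, div_pow]
  have h4 := hs _ hba
  have h5 := hs _ hca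
  have h6 : Real.exp 1 ^ m a = Real.exp 1 ^ b a * Real.exp 1 ^ c := by rw [← pow_add, ← hbc]
  rw [h6]
  field_simp

theorem tendsto_factorial_add_div (i : ℕ) (hm : Tendsto m l atTop) :
    Tendsto (fun a => ((m a + i).factorial : ℝ) / ((m a).factorial * (m a : ℝ) ^ i)) l (𝓝 1) := by
  induction i with
  | zero =>
    refine tendsto_const_nhds.congr fun a => ?_
    have : ((m a).factorial : ℝ) ≠ 0 := by positivity
    simp [this]
  | succ i ih =>
    have hm' : Tendsto (fun a => (m a : ℝ)) l atTop := tendsto_natCast_atTop_atTop.comp hm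
    have h1 : Tendsto (fun a => 1 + ((i : ℝ) + 1) / m a) l (𝓝 (1 + 0)) :=
      (hm'.const_div_atTop _).const_add 1
    have h2 := ih.mul h1
    rw [add_zero, mul_one] at h2
    refine h2.congr' ?_
    filter_upwards [hm.eventually_gt_atTop 0] with a ha
    have hma : (0 : ℝ) < m a := by exact_mod_cast ha
    rw [← add_assoc, Nat.factorial_succ]
    push_cast
    field_simp
    ring

theorem tendsto_starWeight (q i : ℕ) (hm : Tendsto m l atTop)
    (hb : Tendsto (fun a => (2 * (b a : ℝ) - m a) / √(m a)) l (𝓝 y)) :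
    Tendsto (fun a => starWeight q i (m a) (b a) / 2 ^ m a * √(m a) * (m a : ℝ) ^ q / (m a : ℝ) ^ i)
      l (𝓝 (2 ^ q * (√2 / √Real.pi * Real.exp (-y ^ 2 / 2)))) := by
  have hhalf := tendsto_natCast_div_half hm hb
  have hhalf' := tendsto_sub_div_half hm hhalf
  have hbt := tendsto_atTop_of_div_half hm hhalf
  have hct := tendsto_atTop_of_div_half hm hhalf'
  have h := (((tendsto_factorial_add_div i hm).div (tendsto_factorial_add_div q hct)
    one_ne_zero).div (hhalf'.pow q) (by positivity)).mul (tendsto_choose_local hm hb)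
  have e : 1 / 1 / (1 / 2) ^ q * (√2 / √Real.pi * Real.exp (-y ^ 2 / 2)) =
      2 ^ q * (√2 / √Real.pi * Real.exp (-y ^ 2 / 2)) := by simp
  rw [e] at h
  refine h.congr' ?_
  filter_upwards [hm.eventually_gt_atTop 0, eventually_lt_of_div_half hm hhalf] with a ha hlt
  have hma : (0 : ℝ) < m a := by exact_mod_cast ha
  simp only [Pi.div_apply, starWeight]
  rw [Nat.cast_choose ℝ hlt.le, show m a + q - b a = m a - b a + q by omega, div_pow]
  have hca : (0 : ℝ) < ((m a - b a : ℕ) : ℝ) := by exact_mod_cast (by omega : 0 < m a - b a)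
  field_simp

end LocalLimit

/-- The analytic expression for the density, without the ordering condition. -/
noncomputable def melonDensity (p : ℕ) (t : ℝ) (x : Fin p → ℝ) : ℝ :=
  2 ^ (-(p : ℝ) / 2) * Real.pi ^ (-(p : ℝ) / 2) *
    (t * (1 - t)) ^ (-((p : ℝ) ^ 2 / 2)) *
    (∏ i ∈ Finset.range (p - 1), (Nat.factorial (i + 1) : ℝ))⁻¹ *
    (∏ i : Fin p, ∏ j ∈ Finset.Ioi i, (x j - x i) ^ 2) *
    Real.exp (-(∑ i, (x i) ^ 2) / (2 * t * (1 - t)))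

theorem melonDensity_eq_zero {p : ℕ} {t : ℝ} {x : Fin p → ℝ} {i j : Fin p} (hij : i < j)
    (h : x i = x j) : melonDensity p t x = 0 := by
  unfold melonDensity
  rw [Finset.prod_eq_zero (Finset.mem_univ i)
    (Finset.prod_eq_zero (Finset.mem_Ioi.2 hij) (by simp [h]))]
  simp

theorem rpow_neg_half_eq {s : ℝ} (hs : 0 < s) (k : ℕ) : s ^ (-((k : ℝ) / 2)) = (√s ^ k)⁻¹ := by
  rw [Real.rpow_neg hs.le, Real.sqrt_eq_rpow, ← Real.rpow_natCast, ← Real.rpow_mul hs.le]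
  congr 2
  ring

theorem melonDensity_eq_prod {p : ℕ} (hp : 1 ≤ p) {t : ℝ} (ht0 : 0 < t) (ht1 : t < 1)
    (x : Fin p → ℝ) : melonDensity p t x = ∏ i : Fin p,
      (1 / 2 * (2 ^ (p - 1) * (√2 / √Real.pi * Real.exp (-(x i / √t) ^ 2 / 2)) *
        (2 ^ (p - 1) * (√2 / √Real.pi * Real.exp (-(x i / √(1 - t)) ^ 2 / 2))) /
        (2 ^ (p - 1) * (√2 / √Real.pi * Real.exp (-(0 : ℝ) ^ 2 / 2)))) *
        (1 / (√t * √(1 - t))) * (1 / (t * (1 - t))) ^ (p - 1 - (i : ℕ)) *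
        (∏ j ∈ Finset.Ioi i, ((x j - x i) / 2) ^ 2) / ((i : ℕ).factorial : ℝ)) := by
  obtain ⟨q, rfl⟩ : ∃ q, p = q + 1 := ⟨p - 1, by omega⟩
  have ht2 : 0 < 1 - t := by linarith
  have hs : 0 < t * (1 - t) := by positivity
  obtain ⟨K, hK⟩ : ∃ K, K = ∑ i : Fin (q + 1), (q - (i : ℕ)) := ⟨_, rfl⟩
  have hK2 : 2 * K = (q + 1) * q := by
    rw [hK, ← Finset.sum_range (fun i => q - i), ← Finset.sum_range_reflect]
    have h1 : ∑ i ∈ Finset.range (q + 1), (q - (q + 1 - 1 - i)) = ∑ i ∈ Finset.range (q + 1), i :=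
      Finset.sum_congr rfl fun i hi => by have := Finset.mem_range.1 hi; omega
    rw [h1, mul_comm, Finset.sum_range_id_mul_two]
    simp
  have hterm : ∀ i : Fin (q + 1),
      (1 / 2 * (2 ^ (q + 1 - 1) * (√2 / √Real.pi * Real.exp (-(x i / √t) ^ 2 / 2)) *
        (2 ^ (q + 1 - 1) * (√2 / √Real.pi * Real.exp (-(x i / √(1 - t)) ^ 2 / 2))) /
        (2 ^ (q + 1 - 1) * (√2 / √Real.pi * Real.exp (-(0 : ℝ) ^ 2 / 2)))) *
        (1 / (√t * √(1 - t))) * (1 / (t * (1 - t))) ^ (q + 1 - 1 - (i : ℕ)) *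
        (∏ j ∈ Finset.Ioi i, ((x j - x i) / 2) ^ 2) / ((i : ℕ).factorial : ℝ)) =
      (2 ^ q * (√2)⁻¹ * (√Real.pi)⁻¹ * (√(t * (1 - t)))⁻¹) *
        (1 / (4 * (t * (1 - t)))) ^ (q - (i : ℕ)) *
        Real.exp (-(x i) ^ 2 / (2 * t * (1 - t))) * (∏ j ∈ Finset.Ioi i, (x j - x i) ^ 2) *
        ((i : ℕ).factorial : ℝ)⁻¹ := by
    intro i
    have e1 : Real.exp (-(x i) ^ 2 / (2 * t * (1 - t))) =
        Real.exp (-(x i / √t) ^ 2 / 2) * Real.exp (-(x i / √(1 - t)) ^ 2 / 2) := by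
      rw [← Real.exp_add, div_pow, div_pow, Real.sq_sqrt ht0.le, Real.sq_sqrt ht2.le]
      congr 1
      field_simp
      ring
    have e2 : ∏ j ∈ Finset.Ioi i, ((x j - x i) / 2) ^ 2 =
        (∏ j ∈ Finset.Ioi i, (x j - x i) ^ 2) / 4 ^ (q - (i : ℕ)) := by
      simp_rw [div_pow]
      rw [Finset.prod_div_distrib, Finset.prod_const, Fin.card_Ioi]
      norm_num
    have e3 : (√2)⁻¹ = 1 / 2 * √2 := by
      have : √2 * √2 = (2 : ℝ) := Real.mul_self_sqrt (by norm_num)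
      field_simp
      nlinarith
    have e7 : (1 / (4 * (t * (1 - t)))) ^ (q - (i : ℕ)) =
        (1 / (t * (1 - t))) ^ (q - (i : ℕ)) / 4 ^ (q - (i : ℕ)) := by
      rw [← div_pow, div_div, mul_comm 4]
    rw [e1, e2, e3, e7, Real.sqrt_mul ht0.le, Nat.add_sub_cancel]
    simp only [ne_eq, OfNat.ofNat_ne_zero, not_false_eq_true, zero_pow, neg_zero, zero_div,
      Real.exp_zero, mul_one]
    field_simp
  rw [Finset.prod_congr rfl fun i _ => hterm i]
  simp only [Finset.prod_mul_distrib, Finset.prod_const, Finset.card_univ, Fintype.card_fin]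
  rw [Finset.prod_pow_eq_pow_sum, ← hK, ← Real.exp_sum, Finset.prod_inv_distrib,
    ← Finset.sum_div, Finset.sum_neg_distrib]
  unfold melonDensity
  have e4 : ∏ i ∈ Finset.range (q + 1 - 1), ((i + 1).factorial : ℝ) =
      ∏ i : Fin (q + 1), ((i : ℕ).factorial : ℝ) := by
    rw [← Finset.prod_range (fun i => (i.factorial : ℝ)), Finset.prod_range_succ']
    simp
  rw [e4, neg_div, rpow_neg_half_eq (by norm_num), rpow_neg_half_eq Real.pi_pos]
  have e5 : (t * (1 - t)) ^ (-(((q + 1 : ℕ) : ℝ) ^ 2 / 2)) =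
      (√(t * (1 - t)) ^ (q + 1))⁻¹ * ((t * (1 - t)) ^ K)⁻¹ := by
    rw [← Nat.cast_pow, rpow_neg_half_eq hs, ← mul_inv]
    congr 1
    rw [show (q + 1) ^ 2 = (q + 1) + 2 * K by rw [hK2]; ring, pow_add, pow_mul (√_),
      Real.sq_sqrt hs.le]
  have e6 : ((2 : ℝ) ^ q) ^ (q + 1) = 4 ^ K := by
    rw [← pow_mul, mul_comm, ← hK2, pow_mul]
    norm_num
  rw [e5]
  simp only [mul_pow, div_pow, one_pow, inv_pow, e6]
  field_simp

section DensityLimit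

variable {α : Type*} {l : Filter α}

theorem eventually_nonneg_of_tendsto {m : α → ℕ} {z : α → ℤ} {y : ℝ} (hm : Tendsto m l atTop)
    (hz : Tendsto (fun a => (2 * (z a : ℝ) - m a) / √(m a)) l (𝓝 y)) : ∀ᶠ a in l, 0 ≤ z a := by
  have h := hz.div_atTop (tendsto_sqrt_natCast_atTop hm)
  filter_upwards [hm.eventually_gt_atTop 0, h.eventually_const_lt (by norm_num : (-1 : ℝ) < 0)]
    with a ha h1
  have hma : (0 : ℝ) < m a := by exact_mod_cast ha
  rw [div_div, Real.mul_self_sqrt hma.le, lt_div_iff₀ hma] at h1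
  have : (0 : ℝ) < z a := by linarith
  exact_mod_cast this.le

theorem tendsto_starWeight_int (q i : ℕ) {m : α → ℕ} {z : α → ℤ} {y : ℝ} (hm : Tendsto m l atTop)
    (hz : Tendsto (fun a => (2 * (z a : ℝ) - m a) / √(m a)) l (𝓝 y)) :
    (∀ᶠ a in l, ((z a).toNat : ℤ) = z a ∧ (z a).toNat ≤ m a) ∧
    Tendsto (fun a => starWeight q i (m a) (z a).toNat / 2 ^ m a * √(m a) * (m a : ℝ) ^ q /
      (m a : ℝ) ^ i) l (𝓝 (2 ^ q * (√2 / √Real.pi * Real.exp (-y ^ 2 / 2)))) := by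
  have h0 := eventually_nonneg_of_tendsto hm hz
  have h1 : Tendsto (fun a => (2 * ((z a).toNat : ℝ) - m a) / √(m a)) l (𝓝 y) := by
    refine hz.congr' ?_
    filter_upwards [h0] with a ha
    rw [← Int.cast_natCast (R := ℝ) (z a).toNat, Int.toNat_of_nonneg ha]
  refine ⟨?_, tendsto_starWeight q i hm h1⟩
  filter_upwards [h0, eventually_lt_of_div_half hm (tendsto_natCast_div_half hm h1)] with a ha hb
  exact ⟨Int.toNat_of_nonneg ha, hb.le⟩

/-- The local limit theorem for the position of a melon at a fixed time. -/
theorem tendsto_walkDet_ratio {p : ℕ} (hp : 1 ≤ p) {t : ℝ} (ht0 : 0 < t) (ht1 : t < 1)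
    {n m : α → ℕ} (hn : Tendsto n l atTop) (hmn : ∀ a, m a ≤ 2 * n a)
    (hmt : Tendsto (fun a => (m a : ℝ) / (2 * n a)) l (𝓝 t))
    {z : α → Fin p → ℤ} {x : Fin p → ℝ}
    (hz : ∀ i, Tendsto (fun a => (2 * (z a i : ℝ) - m a) / √(2 * n a)) l (𝓝 (x i))) :
    Tendsto (fun a => (√(2 * n a) / 2) ^ p *
      (walkDet (m a) (fun i : Fin p => 2 * ((i : ℕ) : ℤ)) (fun i => 2 * z a i - m a) *
      walkDet (2 * n a - m a) (fun i : Fin p => 2 * ((i : ℕ) : ℤ)) (fun i => 2 * z a i - m a) /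
      walkDet (2 * n a) (fun i : Fin p => 2 * ((i : ℕ) : ℤ)) (fun i => 2 * ((i : ℕ) : ℤ))))
      l (𝓝 (melonDensity p t x)) := by
  have ht2 : 0 < 1 - t := by linarith
  have hN : Tendsto (fun a => 2 * n a) l atTop := hn.const_mul_atTop' (by norm_num)
  have hNR : Tendsto (fun a => 2 * (n a : ℝ)) l atTop :=
    (tendsto_natCast_atTop_atTop.comp hn).const_mul_atTop (by norm_num)
  have hN0 : ∀ᶠ a in l, 0 < 2 * (n a : ℝ) := hNR.eventually_gt_atTop 0
  set r : α → ℕ := fun a => 2 * n a - m a with hr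
  have hrc : ∀ a, (r a : ℝ) = 2 * n a - m a := by
    intro a; rw [hr]; dsimp only; rw [Nat.cast_sub (hmn a)]; push_cast; ring
  have hrt : Tendsto (fun a => (r a : ℝ) / (2 * n a)) l (𝓝 (1 - t)) := by
    refine (hmt.const_sub 1).congr' ?_
    filter_upwards [hN0] with a ha
    have ha' : (0 : ℝ) < n a := by linarith
    rw [hrc]; field_simp
  have hm : Tendsto m l atTop := by
    rw [← tendsto_natCast_atTop_iff (R := ℝ)]
    refine (hmt.pos_mul_atTop ht0 hNR).congr' ?_
    filter_upwards [hN0] with a ha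
    have ha' : (0 : ℝ) < n a := by linarith
    field_simp
  have hrr : Tendsto r l atTop := by
    rw [← tendsto_natCast_atTop_iff (R := ℝ)]
    refine (hrt.pos_mul_atTop ht2 hNR).congr' ?_
    filter_upwards [hN0] with a ha
    have ha' : (0 : ℝ) < n a := by linarith
    field_simp
  have hzm : ∀ i, Tendsto (fun a => (2 * (z a i : ℝ) - m a) / √(m a)) l (𝓝 (x i / √t)) := by
    intro i
    refine ((hz i).div hmt.sqrt (by positivity)).congr' ?_
    filter_upwards [hN0] with a ha
    rw [Pi.div_apply, Real.sqrt_div' _ ha.le]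
    field_simp
  have hzr : ∀ i, Tendsto (fun a => (2 * ((z a i + n a - m a : ℤ) : ℝ) - r a) / √(r a)) l
      (𝓝 (x i / √(1 - t))) := by
    intro i
    refine ((hz i).div hrt.sqrt (by positivity)).congr' ?_
    filter_upwards [hN0] with a ha
    rw [Pi.div_apply, Real.sqrt_div' _ ha.le, hrc]
    push_cast
    field_simp
    ring
  have hzN : ∀ i : Fin p, Tendsto (fun a => (2 * ((n a + (i : ℕ) : ℤ) : ℝ) - (2 * n a : ℕ)) /
      √((2 * n a : ℕ) : ℝ)) l (𝓝 0) := by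
    intro i
    refine ((tendsto_sqrt_natCast_atTop hN).const_div_atTop (2 * (i : ℝ))).congr fun a => ?_
    push_cast
    congr 1
    ring
  have hdiff : ∀ i j, Tendsto (fun a => ((z a j : ℝ) - z a i) / √(2 * n a)) l
      (𝓝 ((x j - x i) / 2)) := by
    intro i j
    refine (((hz j).sub (hz i)).div_const 2).congr fun a => ?_
    ring
  have hsq : Tendsto (fun a => 1 / (√((m a : ℝ) / (2 * n a)) * √((r a : ℝ) / (2 * n a)))) l
      (𝓝 (1 / (√t * √(1 - t)))) :=
    tendsto_const_nhds.div (hmt.sqrt.mul hrt.sqrt) (by positivity)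
  have hpw : Tendsto (fun a => 1 / ((m a : ℝ) / (2 * n a) * ((r a : ℝ) / (2 * n a)))) l
      (𝓝 (1 / (t * (1 - t)))) :=
    tendsto_const_nhds.div (hmt.mul hrt) (by positivity)
  rw [melonDensity_eq_prod hp ht0 ht1]
  have hlim := tendsto_finsetProd Finset.univ (fun (i : Fin p) _ =>
    (((((((tendsto_starWeight_int (p - 1) i hm (hzm i)).2.mul
      (tendsto_starWeight_int (p - 1) i hrr (hzr i)).2).div
      (tendsto_starWeight_int (p - 1) i hN (hzN i)).2 (by positivity)).const_mul (1 / 2)).mul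
      hsq).mul (hpw.pow (p - 1 - (i : ℕ)))).mul
      (tendsto_finsetProd (Finset.Ioi i) fun j _ => (hdiff i j).pow 2)).div_const
        ((i : ℕ).factorial : ℝ))
  refine hlim.congr' ?_
  filter_upwards [hN0, hm.eventually_gt_atTop 0, hrr.eventually_gt_atTop 0,
    eventually_all.2 fun i : Fin p => (tendsto_starWeight_int (p - 1) i hm (hzm i)).1,
    eventually_all.2 fun i : Fin p => (tendsto_starWeight_int (p - 1) i hrr (hzr i)).1,
    eventually_all.2 fun i : Fin p => (tendsto_starWeight_int (p - 1) i hN (hzN i)).1]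
    with a hN0 hm0 hr0 h1 h2 h3
  have hma : (0 : ℝ) < m a := by exact_mod_cast hm0
  have hra : (0 : ℝ) < r a := by exact_mod_cast hr0
  have d1 := walkDet_eq_prod (fun i => (z a i).toNat) (fun i => (h1 i).2)
  have d2 := walkDet_eq_prod (fun i => (z a i + n a - m a).toNat) (fun i => (h2 i).2)
  have d3 := walkDet_eq_prod (fun i : Fin p => (n a + ((i : ℕ) : ℤ)).toNat) (fun i => (h3 i).2)
  have c1 : ∀ i, ((z a i).toNat : ℝ) = z a i := fun i => by
    rw [← Int.cast_natCast, (h1 i).1]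
  have c2 : ∀ i, ((z a i + n a - m a).toNat : ℝ) = z a i + n a - m a := fun i => by
    rw [← Int.cast_natCast, (h2 i).1]; push_cast; ring
  have c3 : ∀ i : Fin p, ((n a + ((i : ℕ) : ℤ)).toNat : ℝ) = n a + (i : ℕ) := fun i => by
    rw [← Int.cast_natCast, (h3 i).1]; push_cast; ring
  have f1 : (fun i => 2 * ((z a i).toNat : ℤ) - (m a : ℤ)) = fun i => 2 * z a i - (m a : ℤ) :=
    funext fun i => by rw [(h1 i).1]
  have f2 : (fun i => 2 * ((z a i + n a - m a).toNat : ℤ) - (r a : ℤ)) =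
      fun i => 2 * z a i - (m a : ℤ) := funext fun i => by
    have := hmn a
    rw [(h2 i).1, hr]; dsimp only; omega
  have f3 : (fun i : Fin p => 2 * ((n a + ((i : ℕ) : ℤ)).toNat : ℤ) - ((2 * n a : ℕ) : ℤ)) =
      fun i : Fin p => 2 * ((i : ℕ) : ℤ) := funext fun i => by
    rw [(h3 i).1]; push_cast; ring
  have g2 : ∀ i j, ((z a j + n a - m a) - (z a i + n a - m a) : ℝ) = z a j - z a i := by
    intros; ring
  have g3 : ∀ i j : Fin p, ((n a + (j : ℕ)) - (n a + (i : ℕ)) : ℝ) = (j : ℕ) - (i : ℕ) := by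
    intros; ring
  have g4 := (Matrix.det_vandermonde fun i : Fin p => ((i : ℕ) : ℝ)).symm.trans
    (det_vandermonde_id_real p)
  rw [f1] at d1
  rw [f2] at d2
  rw [f3] at d3
  simp only [c1, c2, c3, g2, g3, g4] at d1 d2 d3
  rw [show 2 * n a - m a = r a from rfl, d1, d2, d3]
  rw [show (√(2 * (n a : ℝ)) / 2) ^ p = ∏ _i : Fin p, (√(2 * (n a : ℝ)) / 2) by
    rw [Finset.prod_const, Finset.card_univ, Fintype.card_fin]]
  simp only [← Finset.prod_mul_distrib, ← Finset.prod_div_distrib]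
  refine Finset.prod_congr rfl fun i _ => ?_
  have w3 := starWeight_pos (p - 1) i (2 * n a) (n a + ((i : ℕ) : ℤ)).toNat
  have k1 : ∏ j ∈ Finset.Ioi i, (((z a j : ℝ) - z a i) / √(2 * n a)) ^ 2 =
      (∏ j ∈ Finset.Ioi i, ((z a j : ℝ) - z a i)) * (∏ j ∈ Finset.Ioi i, ((z a j : ℝ) - z a i)) /
        (2 * n a) ^ (p - 1 - (i : ℕ)) := by
    simp_rw [div_pow, Real.sq_sqrt hN0.le]
    rw [Finset.prod_div_distrib, Finset.prod_const, Fin.card_Ioi, ← Finset.prod_mul_distrib]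
    simp_rw [sq]
  have k2 : (2 : ℝ) ^ (2 * n a) = 2 ^ m a * 2 ^ r a := by
    rw [← pow_add]; congr 1
    have h4 := hmn a
    have h5 : r a = 2 * n a - m a := rfl
    omega
  obtain ⟨s, hs⟩ : ∃ s, s = p - 1 - (i : ℕ) := ⟨_, rfl⟩
  have k3 : p - 1 = s + i := by have := i.2; omega
  have k4 : (√(2 * (n a : ℝ))) ^ 2 = 2 * n a := Real.sq_sqrt hN0.le
  rw [k1, Real.sqrt_div' _ hN0.le, Real.sqrt_div' _ hN0.le]
  simp only [Pi.div_apply]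
  rw [k2, ← hs]
  simp only [k3] at w3 ⊢
  push_cast
  have k5 : (0 : ℝ) < n a := by linarith
  generalize (∏ j ∈ Finset.Ioi i, ((z a j : ℝ) - z a i)) = V
  generalize starWeight (s + i) i (2 * n a) _ = w₃ at w3 ⊢
  generalize starWeight (s + i) i (r a) _ = w₂
  generalize starWeight (s + i) i (m a) _ = w₁
  obtain ⟨M, hM0, hM⟩ : ∃ M : ℝ, 0 < M ∧ (m a : ℝ) = M ^ 2 :=
    ⟨√(m a), by positivity, (Real.sq_sqrt hma.le).symm⟩
  obtain ⟨R, hR0, hR⟩ : ∃ R : ℝ, 0 < R ∧ (r a : ℝ) = R ^ 2 :=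
    ⟨√(r a), by positivity, (Real.sq_sqrt hra.le).symm⟩
  obtain ⟨N, hN0, hN⟩ : ∃ N : ℝ, 0 < N ∧ 2 * (n a : ℝ) = N ^ 2 :=
    ⟨√(2 * n a), by positivity, k4.symm⟩
  rw [hM, hR, hN, Real.sqrt_sq hM0.le, Real.sqrt_sq hR0.le, Real.sqrt_sq hN0.le]
  simp only [pow_add, mul_pow, div_pow, one_pow, ← pow_mul, mul_comm 2]
  field_simp

end DensityLimit

section Marginal

/-- The half-coordinates of the position of a melon whose rescaled position at time
`⌊2 * n * t⌋` lies in the same lattice cell as `y`. -/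
noncomputable def melonCell {p : ℕ} (t : ℝ) (n : ℕ) (y : Fin p → ℝ) (i : Fin p) : ℤ :=
  ⌊((⌊2 * (n : ℝ) * t⌋₊ : ℝ) + y i * √(2 * n)) / 2⌋

/-- The probability that a melon has half-coordinates `b` at time `⌊2 * n * t⌋`, for strictly
increasing `b`. -/
noncomputable def melonWeight (p : ℕ) (t : ℝ) (n : ℕ) (b : Fin p → ℤ) : ℝ :=
  walkDet ⌊2 * (n : ℝ) * t⌋₊ (fun i : Fin p => 2 * ((i : ℕ) : ℤ))
      (fun i => 2 * b i - (⌊2 * (n : ℝ) * t⌋₊ : ℤ)) *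
    walkDet (2 * n - ⌊2 * (n : ℝ) * t⌋₊) (fun i : Fin p => 2 * ((i : ℕ) : ℤ))
      (fun i => 2 * b i - (⌊2 * (n : ℝ) * t⌋₊ : ℤ)) /
    walkDet (2 * n) (fun i : Fin p => 2 * ((i : ℕ) : ℤ)) (fun i => 2 * ((i : ℕ) : ℤ))

variable {p : ℕ} {t : ℝ}

theorem natFloor_time_le (ht1 : t < 1) (n : ℕ) : ⌊2 * (n : ℝ) * t⌋₊ ≤ 2 * n := by
  refine Nat.floor_le_of_le ?_
  push_cast
  exact mul_le_of_le_one_right (by positivity) ht1.le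

theorem melonCell_mem (y : Fin p → ℝ) {n : ℕ} (hn : 0 < n) (i : Fin p) :
    (2 * (melonCell t n y i : ℝ) - ⌊2 * (n : ℝ) * t⌋₊) / √(2 * n) ∈
      Set.Ioc (y i - 2 / √(2 * n)) (y i) := by
  have hc : 0 < √(2 * (n : ℝ)) := Real.sqrt_pos.2 (by positivity)
  have h1 := Int.floor_le (((⌊2 * (n : ℝ) * t⌋₊ : ℝ) + y i * √(2 * n)) / 2)
  have h2 := Int.lt_floor_add_one (((⌊2 * (n : ℝ) * t⌋₊ : ℝ) + y i * √(2 * n)) / 2)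
  change (melonCell t n y i : ℝ) ≤ _ at h1
  change _ < (melonCell t n y i : ℝ) + 1 at h2
  constructor
  · rw [lt_div_iff₀ hc, sub_mul, div_mul_cancel₀ _ hc.ne']
    linarith
  · rw [div_le_iff₀ hc]
    linarith

theorem tendsto_sqrt_two_mul : Tendsto (fun n : ℕ => √(2 * (n : ℝ))) atTop atTop :=
  Real.tendsto_sqrt_atTop.comp (tendsto_natCast_atTop_atTop.const_mul_atTop (by norm_num))

theorem tendsto_melonCell (t : ℝ) (x : Fin p → ℝ) (i : Fin p) :
    Tendsto (fun a : ℕ × (Fin p → ℝ) =>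
      (2 * (melonCell t a.1 a.2 i : ℝ) - ⌊2 * (a.1 : ℝ) * t⌋₊) / √(2 * a.1))
      (atTop ×ˢ 𝓝 x) (𝓝 (x i)) := by
  have h2 : Tendsto (fun a : ℕ × (Fin p → ℝ) => a.2 i) (atTop ×ˢ 𝓝 x) (𝓝 (x i)) :=
    ((continuous_apply i).tendsto x).comp tendsto_snd
  have h1 : Tendsto (fun a : ℕ × (Fin p → ℝ) => a.2 i - 2 / √(2 * (a.1 : ℝ)))
      (atTop ×ˢ 𝓝 x) (𝓝 (x i)) := by
    simpa using h2.sub ((tendsto_sqrt_two_mul.comp tendsto_fst).const_div_atTop 2)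
  refine tendsto_of_tendsto_of_tendsto_of_le_of_le' h1 h2 ?_ ?_ <;>
  · filter_upwards [tendsto_fst.eventually (eventually_gt_atTop 0)] with a ha
    have := melonCell_mem (t := t) a.2 ha i
    first | exact this.1.le | exact this.2

theorem tendsto_natFloor_time (ht0 : 0 < t) :
    Tendsto (fun n : ℕ => (⌊2 * (n : ℝ) * t⌋₊ : ℝ) / (2 * n)) atTop (𝓝 t) := by
  refine ((tendsto_nat_floor_mul_div_atTop ht0.le).comp
    (tendsto_natCast_atTop_atTop.const_mul_atTop (by norm_num : (0 : ℝ) < 2))).congr fun n => ?_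
  simp only [Function.comp_apply]
  rw [mul_comm t]

theorem tendsto_melonWeight (hp : 1 ≤ p) (ht0 : 0 < t) (ht1 : t < 1) (x : Fin p → ℝ) :
    Tendsto (fun a : ℕ × (Fin p → ℝ) =>
      (√(2 * a.1) / 2) ^ p * melonWeight p t a.1 (melonCell t a.1 a.2))
      (atTop ×ˢ 𝓝 x) (𝓝 (melonDensity p t x)) :=
  tendsto_walkDet_ratio hp ht0 ht1 tendsto_fst (fun a => natFloor_time_le ht1 a.1)
    ((tendsto_natFloor_time ht0).comp tendsto_fst) (tendsto_melonCell t x)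

theorem exists_bound_melonWeight (hp : 1 ≤ p) (ht0 : 0 < t) (ht1 : t < 1) {K : Set (Fin p → ℝ)}
    (hK : IsCompact K) : ∃ C : ℝ, ∀ᶠ n : ℕ in atTop, ∀ y ∈ K,
      |(√(2 * n) / 2) ^ p * melonWeight p t n (melonCell t n y)| ≤ C := by
  refine hK.induction_on ⟨0, by simp⟩ ?_ ?_ ?_
  · rintro s s' hs ⟨C, hC⟩
    exact ⟨C, hC.mono fun n h y hy => h y (hs hy)⟩
  · rintro s s' ⟨C, hC⟩ ⟨C', hC'⟩
    refine ⟨max C C', ?_⟩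
    filter_upwards [hC, hC'] with n h h'
    rintro y (hy | hy)
    · exact (h y hy).trans (le_max_left _ _)
    · exact (h' y hy).trans (le_max_right _ _)
  · intro x _
    have h := (tendsto_melonWeight hp ht0 ht1 x).abs.eventually
      (eventually_le_nhds (lt_add_one |melonDensity p t x|))
    obtain ⟨pa, hpa, pb, hpb, hab⟩ := eventually_prod_iff.1 h
    exact ⟨{y | pb y}, mem_nhdsWithin_of_mem_nhds hpb, _, hpa.mono fun n hn y hy => hab hn hy⟩

theorem melonCell_eq_iff {n : ℕ} (hn : 0 < n) (y : Fin p → ℝ) (b : Fin p → ℤ) :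
    melonCell t n y = b ↔ y ∈ Set.univ.pi fun i =>
      Set.Ico ((2 * (b i : ℝ) - ⌊2 * (n : ℝ) * t⌋₊) / √(2 * n))
        ((2 * (b i : ℝ) + 2 - ⌊2 * (n : ℝ) * t⌋₊) / √(2 * n)) := by
  have hc : 0 < √(2 * (n : ℝ)) := Real.sqrt_pos.2 (by positivity)
  rw [funext_iff, Set.mem_univ_pi]
  refine forall_congr' fun i => ?_
  rw [melonCell, Int.floor_eq_iff, Set.mem_Ico, div_le_iff₀ hc, lt_div_iff₀ hc]
  constructor <;> rintro ⟨h1, h2⟩ <;> constructor <;> linarith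

theorem sum_eq_integral_melonCell {n : ℕ} (hn : 0 < n) (S : Finset (Fin p → ℤ))
    (g : (Fin p → ℤ) → ℝ) : ∑ b ∈ S, g b =
      ∫ y : Fin p → ℝ, if melonCell t n y ∈ S then
        (√(2 * n) / 2) ^ p * g (melonCell t n y) else 0 := by
  have hc : 0 < √(2 * (n : ℝ)) := Real.sqrt_pos.2 (by positivity)
  classical
  set B : (Fin p → ℤ) → Set (Fin p → ℝ) := fun b => Set.univ.pi fun i =>
      Set.Ico ((2 * (b i : ℝ) - ⌊2 * (n : ℝ) * t⌋₊) / √(2 * n))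
        ((2 * (b i : ℝ) + 2 - ⌊2 * (n : ℝ) * t⌋₊) / √(2 * n)) with hB
  have hBm : ∀ b, MeasurableSet (B b) := fun b => MeasurableSet.univ_pi fun i => measurableSet_Ico
  have hvol : ∀ b, volume.real (B b) = (2 / √(2 * (n : ℝ))) ^ p := by
    intro b
    rw [Measure.real, hB, Real.volume_pi_Ico_toReal]
    · rw [Finset.prod_congr rfl fun i _ => show _ = 2 / √(2 * (n : ℝ)) by ring,
        Finset.prod_const, Finset.card_univ, Fintype.card_fin]
    · intro i
      dsimp only
      gcongr
      linarith
  have hfin : ∀ b, volume (B b) ≠ ⊤ := by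
    intro b h
    have := hvol b
    rw [Measure.real, h] at this
    exact absurd this (by positivity)
  have h : ∀ y : Fin p → ℝ, (if melonCell t n y ∈ S then
        (√(2 * n) / 2) ^ p * g (melonCell t n y) else 0) =
      ∑ b ∈ S, (B b).indicator (fun _ => (√(2 * (n : ℝ)) / 2) ^ p * g b) y := by
    intro y
    rw [← Finset.sum_ite_eq S (melonCell t n y) fun b => (√(2 * (n : ℝ)) / 2) ^ p * g b]
    refine Finset.sum_congr rfl fun b _ => ?_
    rw [Set.indicator_apply]
    exact if_congr (melonCell_eq_iff hn y b) rfl rfl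
  simp_rw [h]
  rw [integral_finsetSum]
  · refine Finset.sum_congr rfl fun b _ => ?_
    rw [integral_indicator_const _ (hBm b), hvol, smul_eq_mul, ← mul_assoc, ← mul_pow]
    rw [show 2 / √(2 * (n : ℝ)) * (√(2 * n) / 2) = 1 by field_simp]
    simp
  · intro b _
    exact (integrable_indicator_iff (hBm b)).2 (integrableOn_const (hfin b))

/-- The half-coordinates of lattice points in the rescaled box. -/
noncomputable def boxHalfCoords (t : ℝ) (n : ℕ) (u v : Fin p → ℝ) : Finset (Fin p → ℤ) :=
  Fintype.piFinset fun i => Finset.Icc ⌈(u i * √(2 * n) + ⌊2 * (n : ℝ) * t⌋₊) / 2⌉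
    ⌊(v i * √(2 * n) + ⌊2 * (n : ℝ) * t⌋₊) / 2⌋

theorem mem_boxHalfCoords {n : ℕ} {u v : Fin p → ℝ} {b : Fin p → ℤ} :
    b ∈ boxHalfCoords t n u v ↔ ∀ i, u i * √(2 * n) ≤ 2 * (b i : ℝ) - ⌊2 * (n : ℝ) * t⌋₊ ∧
      2 * (b i : ℝ) - ⌊2 * (n : ℝ) * t⌋₊ ≤ v i * √(2 * n) := by
  rw [boxHalfCoords, Fintype.mem_piFinset]
  refine forall_congr' fun i => ?_
  rw [Finset.mem_Icc, Int.ceil_le, Int.le_floor]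
  constructor <;> rintro ⟨h1, h2⟩ <;> constructor <;> linarith

theorem probNW_box_eq_sum (ht1 : t < 1) (n : ℕ) (u v : Fin p → ℝ) :
    probNW p n (fun w => ∀ i,
      u i * √(2 * n) ≤ (w i ⌊2 * (n : ℝ) * t⌋₊ : ℝ) ∧
      (w i ⌊2 * (n : ℝ) * t⌋₊ : ℝ) ≤ v i * √(2 * n)) =
    ∑ b ∈ boxHalfCoords t n u v, ({b | StrictMono b} : Set (Fin p → ℤ)).indicator
      (melonWeight p t n) b := by
  classical
  set m := ⌊2 * (n : ℝ) * t⌋₊ with hm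
  have hmn : m ≤ 2 * n := natFloor_time_le ht1 n
  have hev : ∀ w : Fin p → ℕ → ℤ, (IsMelonNW p n w ∧ ∀ i, u i * √(2 * n) ≤ (w i m : ℝ) ∧
      (w i m : ℝ) ≤ v i * √(2 * n)) ↔
      IsMelonNW p n w ∧ ∃ a ∈ boxHalfCoords t n u v, ∀ i, w i m = 2 * a i - m := by
    intro w
    refine and_congr_right fun hw => ⟨fun h => ?_, ?_⟩
    · choose a ha using fun i => (hw.1.even_add i hmn).two_dvd
      have hwa : ∀ i, w i m = 2 * a i - m := fun i => by have := ha i; omega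
      refine ⟨a, mem_boxHalfCoords.2 fun i => ?_, hwa⟩
      have := h i
      rw [hwa i] at this
      push_cast at this
      exact this
    · rintro ⟨a, ha, hwa⟩ i
      have := mem_boxHalfCoords.1 ha i
      rw [hwa i]
      push_cast
      exact this
  rw [probNW, Nat.card_congr (Equiv.subtypeEquivRight hev), card_isMelonNW,
    card_isMelonNW_event p n m hmn, Finset.sum_div]
  refine Finset.sum_congr rfl fun b _ => ?_
  rw [Set.indicator_apply]
  simp only [Set.mem_ofPred_eq, melonWeight]
  split_ifs <;> simp [hm]

theorem measurable_melonCell (t : ℝ) (n : ℕ) :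
    Measurable (melonCell t n : (Fin p → ℝ) → Fin p → ℤ) :=
  measurable_pi_iff.2 fun i => Int.measurable_floor.comp
    (((measurable_pi_apply i).mul_const _).const_add _ |>.div_const 2)

theorem tendsto_pair_atTop_nhds (x : Fin p → ℝ) :
    Tendsto (fun n : ℕ => (n, x)) atTop (atTop ×ˢ 𝓝 x) :=
  tendsto_id.prodMk tendsto_const_nhds

theorem tendsto_melonCell_apply (t : ℝ) (x : Fin p → ℝ) (i : Fin p) :
    Tendsto (fun n : ℕ => (2 * (melonCell t n x i : ℝ) - ⌊2 * (n : ℝ) * t⌋₊) / √(2 * n))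
      atTop (𝓝 (x i)) := by
  have h := (tendsto_melonCell t x i).comp (tendsto_pair_atTop_nhds x)
  simpa only [Function.comp_def] using h

theorem eventually_sqrt_two_mul_pos : ∀ᶠ n : ℕ in atTop, 0 < √(2 * (n : ℝ)) :=
  tendsto_sqrt_two_mul.eventually_gt_atTop 0

theorem eventually_melonCell_lt {x : Fin p → ℝ} {i j : Fin p} (h : x i < x j) :
    ∀ᶠ n : ℕ in atTop, melonCell t n x i < melonCell t n x j := by
  filter_upwards [(tendsto_melonCell_apply t x i).eventually_lt (tendsto_melonCell_apply t x j) h,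
    eventually_sqrt_two_mul_pos] with n hn hc
  rw [div_lt_div_iff_of_pos_right hc] at hn
  have : (melonCell t n x i : ℝ) < melonCell t n x j := by linarith
  exact_mod_cast this

theorem tendsto_melonWeight_strictMono (hp : 1 ≤ p) (ht0 : 0 < t) (ht1 : t < 1) (x : Fin p → ℝ) :
    Tendsto (fun n : ℕ => (√(2 * n) / 2) ^ p *
      ({b | StrictMono b} : Set (Fin p → ℤ)).indicator (melonWeight p t n) (melonCell t n x))
      atTop (𝓝 (fHat p t x)) := by
  classical
  have hlim : Tendsto (fun n : ℕ => (√(2 * n) / 2) ^ p * melonWeight p t n (melonCell t n x))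
      atTop (𝓝 (melonDensity p t x)) := by
    have h := (tendsto_melonWeight hp ht0 ht1 x).comp (tendsto_pair_atTop_nhds x)
    simpa only [Function.comp_def] using h
  by_cases hx : StrictMono x
  · have hf : fHat p t x = melonDensity p t x := if_pos fun i j hij => hx.monotone hij
    rw [hf]
    refine hlim.congr' ?_
    have h : ∀ᶠ n : ℕ in atTop, ∀ i j : Fin p, i < j → melonCell t n x i < melonCell t n x j :=
      eventually_all.2 fun i => eventually_all.2 fun j => eventually_imp_distrib_left.2 fun hij =>
        eventually_melonCell_lt (hx hij)
    filter_upwards [h] with n hn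
    rw [Set.indicator_of_mem]
    exact fun i j hij => hn i j hij
  · obtain ⟨i, j, hij, hxij⟩ : ∃ i j, i < j ∧ x j ≤ x i := by
      simpa [StrictMono] using hx
    rcases hxij.lt_or_eq with hlt | heq
    · have hf : fHat p t x = 0 := if_neg fun h => (h i j hij.le).not_gt hlt
      rw [hf]
      refine tendsto_const_nhds.congr' ?_
      filter_upwards [eventually_melonCell_lt (t := t) hlt] with n hn
      rw [Set.indicator_of_notMem, mul_zero]
      exact fun h => (h hij).not_gt hn
    · have h0 := melonDensity_eq_zero (t := t) hij heq.symm
      have hf : fHat p t x = 0 := by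
        change (if _ then melonDensity p t x else 0) = 0
        rw [h0, ite_self]
      rw [h0] at hlim
      rw [hf]
      refine squeeze_zero_norm (fun n => ?_) (tendsto_zero_iff_norm_tendsto_zero.1 hlim)
      rw [norm_mul, norm_mul]
      gcongr
      exact norm_indicator_le_norm_self _ _

theorem tendsto_box_melonWeight (hp : 1 ≤ p) (ht0 : 0 < t) (ht1 : t < 1) {u v x : Fin p → ℝ}
    (hu : ∀ i, x i ≠ u i) (hv : ∀ i, x i ≠ v i) :
    Tendsto (fun n : ℕ => if melonCell t n x ∈ boxHalfCoords t n u v then (√(2 * n) / 2) ^ p *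
      ({b | StrictMono b} : Set (Fin p → ℤ)).indicator (melonWeight p t n) (melonCell t n x)
      else 0) atTop
      (𝓝 ((Set.univ.pi fun i => Set.Icc (u i) (v i)).indicator (fHat p t) x)) := by
  by_cases hx : x ∈ Set.univ.pi fun i => Set.Icc (u i) (v i)
  · rw [Set.indicator_of_mem hx]
    refine (tendsto_melonWeight_strictMono hp ht0 ht1 x).congr' ?_
    have h : ∀ᶠ n : ℕ in atTop, ∀ i,
        (2 * (melonCell t n x i : ℝ) - ⌊2 * (n : ℝ) * t⌋₊) / √(2 * n) ∈ Set.Ioo (u i) (v i) :=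
      eventually_all.2 fun i => (tendsto_melonCell_apply t x i).eventually
        (Ioo_mem_nhds ((hx i trivial).1.lt_of_ne' (hu i)) ((hx i trivial).2.lt_of_ne (hv i)))
    filter_upwards [h, eventually_sqrt_two_mul_pos] with n hn hc
    rw [if_pos]
    refine mem_boxHalfCoords.2 fun i => ?_
    have := hn i
    rw [Set.mem_Ioo, lt_div_iff₀ hc, div_lt_iff₀ hc] at this
    exact ⟨this.1.le, this.2.le⟩
  · rw [Set.indicator_of_notMem hx]
    refine tendsto_const_nhds.congr' ?_
    obtain ⟨i, hi⟩ : ∃ i, x i ∉ Set.Icc (u i) (v i) := by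
      simpa only [Set.mem_univ_pi, not_forall] using hx
    filter_upwards [(tendsto_melonCell_apply t x i).eventually
      (isClosed_Icc.isOpen_compl.mem_nhds hi), eventually_sqrt_two_mul_pos] with n hn hc
    rw [if_neg]
    intro h
    have := mem_boxHalfCoords.1 h i
    exact hn ⟨(le_div_iff₀ hc).2 this.1, (div_le_iff₀ hc).2 this.2⟩

theorem mem_of_melonCell_mem {n : ℕ} (hn : 0 < n) {u v y : Fin p → ℝ}
    (h : melonCell t n y ∈ boxHalfCoords t n u v) (hc : 2 ≤ √(2 * (n : ℝ))) :
    y ∈ Set.univ.pi fun i => Set.Icc (u i) (v i + 1) := by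
  have hc0 : 0 < √(2 * (n : ℝ)) := by linarith
  intro i _
  have h1 := mem_boxHalfCoords.1 h i
  have h2 := melonCell_mem (t := t) y hn i
  have h3 : 2 / √(2 * (n : ℝ)) ≤ 1 := (div_le_one hc0).2 hc
  rw [← le_div_iff₀ hc0, ← div_le_iff₀ hc0] at h1
  exact ⟨h1.1.trans h2.2, by linarith [h1.2, h2.1]⟩

end Marginal

/-- convergence of the rescaled one-dimensional marginals of the
uniform `(p,2n)`-watermelon without wall condition to `f̂(t;·)`. -/
theorem melonNW_marginal_box_tendsto (p : ℕ) (hp : 1 ≤ p) (t : ℝ)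
    (ht0 : 0 < t) (ht1 : t < 1) (u v : Fin p → ℝ) (huv : ∀ i, u i < v i) :
    Tendsto (fun n : ℕ =>
        probNW p n (fun w => ∀ i,
          u i * Real.sqrt (2 * n) ≤ (w i ⌊2 * (n : ℝ) * t⌋₊ : ℝ) ∧
          (w i ⌊2 * (n : ℝ) * t⌋₊ : ℝ) ≤ v i * Real.sqrt (2 * n)))
      atTop
      (nhds (∫ x in Set.univ.pi fun i => Set.Icc (u i) (v i), fHat p t x)) := by
  have hmeas : ∀ a b : Fin p → ℝ, MeasurableSet (Set.univ.pi fun i => Set.Icc (a i) (b i)) :=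
    fun a b => MeasurableSet.univ_pi fun i => measurableSet_Icc
  have hK : IsCompact (Set.univ.pi fun i => Set.Icc (u i) (v i + 1)) :=
    isCompact_univ_pi fun i => isCompact_Icc
  obtain ⟨C, hC⟩ := exists_bound_melonWeight hp ht0 ht1 hK
  rw [← integral_indicator (hmeas u v)]
  refine Tendsto.congr' (EventuallyEq.symm ?_) (tendsto_integral_filter_of_dominated_convergence
    ((Set.univ.pi fun i => Set.Icc (u i) (v i + 1)).indicator fun _ => C)
    (F := fun (n : ℕ) x => if melonCell t n x ∈ boxHalfCoords t n u v then (√(2 * n) / 2) ^ p *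
      ({b | StrictMono b} : Set (Fin p → ℤ)).indicator (melonWeight p t n) (melonCell t n x)
      else 0) ?_ ?_ ?_ ?_)
  · filter_upwards [eventually_gt_atTop 0] with n hn
    rw [probNW_box_eq_sum ht1, sum_eq_integral_melonCell hn]
  · refine Eventually.of_forall fun n => Measurable.aestronglyMeasurable ?_
    exact (Measurable.of_discrete (f := fun b : Fin p → ℤ => if b ∈ boxHalfCoords t n u v then
      (√(2 * (n : ℝ)) / 2) ^ p * ({b | StrictMono b} : Set (Fin p → ℤ)).indicator
        (melonWeight p t n) b else 0)).comp (measurable_melonCell t n)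
  · filter_upwards [hC, eventually_gt_atTop 0, tendsto_sqrt_two_mul.eventually_ge_atTop 2]
      with n hCn hn hc
    refine Eventually.of_forall fun y => ?_
    split_ifs with h
    · have hy := mem_of_melonCell_mem hn h hc
      rw [Set.indicator_of_mem hy]
      refine le_trans ?_ (hCn y hy)
      rw [← Real.norm_eq_abs, norm_mul, norm_mul]
      gcongr
      exact norm_indicator_le_norm_self _ _
    · rw [norm_zero]
      exact Set.indicator_nonneg (fun y hy => (abs_nonneg _).trans (hCn y hy)) y
  · exact (integrable_indicator_iff (hmeas _ _)).2 (integrableOn_const hK.measure_ne_top)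
  · have hne : ∀ a : Fin p → ℝ, ∀ᵐ x : Fin p → ℝ, ∀ i, x i ≠ a i := fun a =>
      by
      rw [volume_pi]
      exact eventually_all.2 fun i => Measure.ae_eval_ne (α := fun _ : Fin p => ℝ)
        (μ := fun _ => volume) i (x := a i)
    filter_upwards [hne u, hne v] with x hu hv
    exact tendsto_box_melonWeight hp ht0 ht1 hu hv
end

section
/- Fix an integer p ≥ 1, t ∈ (0,1), and a compact set K contained in the open chamber { x ∈ ℝ^p : x_1 < ⋯ < x_p }. Then there exist C > 0 and n₀ such that for all n ≥ n₀ and all x ∈ K with x_i·√(2n) ∈ ℤ and x_i·√(2n) ≡ ⌊2nt⌋ (mod 2) for every i, one has | P( Ŵ_i(⌊2nt⌋) = x_i·√(2n) for all i ) / ( (2/n)^{p/2} · f̂(t;x) ) − 1 | ≤ C/√n, where P is the uniform probability on (p,2n)-watermelons without wall condition. -/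
open MeasureTheory Filter

section VandermondeIdentity

open Polynomial Matrix

lemma natDegree_stepPoly_le (A : ℝ) (k : ℕ) :
    ((C A - X) * X ^ k + X * (X + C (-1)) ^ k : ℝ[X]).natDegree ≤ k := by
  rw [natDegree_le_iff_coeff_eq_zero]
  intro N hN
  obtain ⟨N, rfl⟩ : ∃ M, N = M + 1 := ⟨N - 1, by omega⟩
  rw [coeff_add, sub_mul, coeff_sub, coeff_C_mul, coeff_X_mul, coeff_X_mul, coeff_X_pow,
    coeff_X_pow, coeff_X_add_C_pow, if_neg (by omega)]
  rcases (by omega : N = k ∨ k < N) with rfl | h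
  · simp
  · simp [Nat.choose_eq_zero_of_lt h, h.ne']

lemma coeff_stepPoly_self (A : ℝ) (k : ℕ) :
    ((C A - X) * X ^ k + X * (X + C (-1)) ^ k : ℝ[X]).coeff k = A - k := by
  rcases k with _ | k
  · simp
  · rw [coeff_add, sub_mul, coeff_sub, coeff_C_mul, coeff_X_mul, coeff_X_mul, coeff_X_pow,
      coeff_X_pow, coeff_X_add_C_pow, Nat.choose_succ_self_right]
    simp
    ring

/-- The Vandermonde determinant is an eigenfunction of the one-step operator of `p` particles
jumping down with weight `a i` and staying with weight `A - a i`. -/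
lemma sum_weight_mul_det_vandermonde {p : ℕ} (A : ℝ) (a : Fin p → ℝ) :
    ∑ s : Finset (Fin p), (∏ i, if i ∈ s then a i else A - a i) *
      (vandermonde fun i => a i - if i ∈ s then 1 else 0).det =
    (∏ k : Fin p, (A - (k : ℕ))) * (vandermonde a).det := by
  have hrhs : (Matrix.of fun i k : Fin p =>
      (((C A - X) * X ^ (k : ℕ) + X * (X + C (-1)) ^ (k : ℕ) : ℝ[X]).eval (a i))).det =
      (∏ k : Fin p, (A - (k : ℕ))) * (vandermonde a).det := by
    rw [eval_matrixOfPolynomials_eq_vandermonde_mul_matrixOfPolynomials _ _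
      (fun i => natDegree_stepPoly_le A i), det_mul,
      det_of_isUpperTriangular
        (matrixOfPolynomials_blockTriangular _ fun i => natDegree_stepPoly_le A i), mul_comm]
    simp only [of_apply, coeff_stepPoly_self]
  rw [← hrhs]
  have hsplit : (Matrix.of fun i k : Fin p =>
      (((C A - X) * X ^ (k : ℕ) + X * (X + C (-1)) ^ (k : ℕ) : ℝ[X]).eval (a i))) =
      (fun i k : Fin p => a i * (a i - 1) ^ (k : ℕ)) +
        (fun i k : Fin p => (A - a i) * a i ^ (k : ℕ)) := by
    ext i k
    simp
    ring
  rw [hsplit]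
  refine Eq.trans ?_ (detRowAlternating.map_add_univ _ _).symm
  refine Finset.sum_congr rfl fun s _ => ?_
  rw [← det_mul_column]
  change _ = det _
  congr 1
  ext i k
  by_cases h : i ∈ s <;> simp [h, vandermonde_apply]

end VandermondeIdentity

/-- The reciprocal factorial, extended by zero to the negative integers. -/
noncomputable def invFact (k : ℤ) : ℝ := if 0 ≤ k then ((k.toNat.factorial : ℕ) : ℝ)⁻¹ else 0

lemma invFact_natCast (k : ℕ) : invFact k = ((k.factorial : ℕ) : ℝ)⁻¹ := by
  simp [invFact]

lemma invFact_of_neg {k : ℤ} (hk : k < 0) : invFact k = 0 := by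
  simp [invFact, hk]

lemma invFact_sub_one (k : ℤ) : invFact (k - 1) = k * invFact k := by
  rcases lt_trichotomy k 0 with h | rfl | h
  · rw [invFact_of_neg h, invFact_of_neg (by omega), mul_zero]
  · rw [invFact_of_neg (by norm_num)]; simp
  · obtain ⟨j, rfl⟩ : ∃ j : ℕ, k = (j + 1 : ℕ) := ⟨(k - 1).toNat, by omega⟩
    rw [show ((j + 1 : ℕ) : ℤ) - 1 = (j : ℕ) by push_cast; ring, invFact_natCast, invFact_natCast,
      Nat.factorial_succ]
    have : (j.factorial : ℝ) ≠ 0 := by positivity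
    push_cast
    field_simp

/-- The product formula for the number of stars of length `m` whose `i`-th branch ends
at `2 * a i - m`. -/
noncomputable def starFormula (p m : ℕ) (a : Fin p → ℤ) : ℝ :=
  (∏ i : Fin p, ((m + i).factorial : ℝ) * invFact (a i) * invFact (m + p - 1 - a i)) *
    (Matrix.vandermonde fun i => (a i : ℝ)).det

lemma starFormula_eq_zero {p m : ℕ} {a : Fin p → ℤ} (h : ¬ Function.Injective a) :
    starFormula p m a = 0 := by
  have : (Matrix.vandermonde fun i => (a i : ℝ)).det = 0 := by
    by_contra hne
    rw [← Ne, Matrix.det_vandermonde_ne_zero_iff] at hne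
    exact h fun i j hij => hne (by simp [hij])
  rw [starFormula, this, mul_zero]

lemma starFormula_succ (p m : ℕ) (a : Fin p → ℤ) :
    starFormula p (m + 1) a =
      ∑ s : Finset (Fin p), starFormula p m fun i => a i - if i ∈ s then 1 else 0 := by
  have key : ∀ s : Finset (Fin p), (starFormula p m fun i => a i - if i ∈ s then 1 else 0) =
      (∏ i : Fin p, ((m + i).factorial : ℝ) * invFact (a i) * invFact (m + p - a i)) *
      ((∏ i, if i ∈ s then (a i : ℝ) else ((m + p : ℕ) : ℝ) - a i) *
      (Matrix.vandermonde fun i => (a i : ℝ) - if i ∈ s then 1 else 0).det) := by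
    intro s
    rw [starFormula, ← mul_assoc, ← Finset.prod_mul_distrib]
    congr 1
    · refine Finset.prod_congr rfl fun i _ => ?_
      by_cases h : i ∈ s
      · simp only [h, if_true]
        rw [invFact_sub_one, show (m : ℤ) + p - 1 - (a i - 1) = m + p - a i by ring]
        ring
      · simp only [h, if_false, sub_zero]
        rw [show (m : ℤ) + p - 1 - a i = (m + p - a i) - 1 by ring, invFact_sub_one]
        push_cast
        ring
    · congr 2
      ext i
      split_ifs <;> simp
  simp_rw [key]
  rw [← Finset.mul_sum, sum_weight_mul_det_vandermonde, starFormula, ← mul_assoc]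
  congr 1
  have h1 : ∏ k : Fin p, (((m + p : ℕ) : ℝ) - (k : ℕ)) = ∏ k : Fin p, ((m : ℝ) + 1 + (k : ℕ)) := by
    rw [← Equiv.prod_comp Fin.revPerm]
    refine Finset.prod_congr rfl fun i _ => ?_
    rw [Fin.revPerm_apply, Fin.val_rev, Nat.cast_sub (by omega)]
    push_cast
    ring
  rw [h1, ← Finset.prod_mul_distrib]
  refine Finset.prod_congr rfl fun i _ => ?_
  rw [show m + 1 + (i : ℕ) = (m + i) + 1 by ring, Nat.factorial_succ]
  push_cast
  rw [show (m : ℤ) + 1 + p - 1 - a i = m + p - a i by ring]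
  ring

lemma det_vandermonde_fin {p : ℕ} (hp : 1 ≤ p) :
    (Matrix.vandermonde fun i : Fin p => ((i : ℕ) : ℝ)).det =
      ∏ i : Fin p, ((i : ℕ).factorial : ℝ) := by
  obtain ⟨q, rfl⟩ : ∃ q, p = q + 1 := ⟨p - 1, by omega⟩
  rw [Matrix.det_vandermonde_id_eq_superFactorial, ← Nat.prod_range_succ_factorial,
    Fin.prod_univ_eq_prod_range (fun i => ((i.factorial : ℕ) : ℝ)) (q + 1)]
  push_cast
  rfl

lemma starFormula_zero_val {p : ℕ} (hp : 1 ≤ p) :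
    starFormula p 0 (fun i => ((i : ℕ) : ℤ)) = 1 := by
  rw [starFormula]
  have h := det_vandermonde_fin hp
  simp only [Int.cast_natCast]
  rw [h, ← Finset.prod_mul_distrib]
  have h1 : ∀ i : Fin p, ((0 + (i : ℕ)).factorial : ℝ) * invFact ((i : ℕ) : ℤ) *
      invFact (((0 : ℕ) : ℤ) + p - 1 - ((i : ℕ) : ℤ)) * ((i : ℕ).factorial : ℝ) =
      ((i.rev : ℕ).factorial : ℝ)⁻¹ * ((i : ℕ).factorial : ℝ) := by
    intro i
    rw [show ((0 : ℕ) : ℤ) + p - 1 - ((i : ℕ) : ℤ) = ((i.rev : ℕ) : ℤ) by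
      rw [Fin.val_rev]; push_cast [Nat.cast_sub (show (i : ℕ) + 1 ≤ p by omega)]; ring,
      invFact_natCast, invFact_natCast, zero_add]
    have : ((i : ℕ).factorial : ℝ) ≠ 0 := by positivity
    field_simp
  rw [Finset.prod_congr rfl fun i _ => h1 i, Finset.prod_mul_distrib, Finset.prod_inv_distrib,
    ← Equiv.prod_comp Fin.revPerm fun i : Fin p => ((i : ℕ).factorial : ℝ)]
  simp only [Fin.revPerm_apply]
  exact inv_mul_cancel₀ (Finset.prod_ne_zero_iff.mpr fun i _ => by positivity)

lemma sub_le_of_strictMono {p : ℕ} {a : Fin p → ℤ} (ha : StrictMono a) {i j : Fin p}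
    (hij : i ≤ j) : ((j : ℕ) : ℤ) - ((i : ℕ) : ℤ) ≤ a j - a i := by
  obtain ⟨i, hi⟩ := i
  obtain ⟨j, hj⟩ := j
  have hij' : i ≤ j := hij
  induction j, hij' using Nat.le_induction with
  | base => simp
  | succ j hj' ih =>
    have h1 := ih (by omega) (by simpa using hj')
    have h2 : a ⟨j, by omega⟩ < a ⟨j + 1, hj⟩ := ha (by simp)
    simp only [Nat.cast_add, Nat.cast_one] at *
    omega

lemma starFormula_zero_of_ne {p : ℕ} (hp : 1 ≤ p) {a : Fin p → ℤ} (ha : StrictMono a)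
    (hne : a ≠ fun i : Fin p => ((i : ℕ) : ℤ)) : starFormula p 0 a = 0 := by
  have hout : ∃ i, a i < 0 ∨ (p : ℤ) - 1 < a i := by
    by_contra! hcon
    apply hne
    ext i
    have h1 := sub_le_of_strictMono ha (i := ⟨0, hp⟩) (j := i) (Fin.mk_le_of_le_val (by simp))
    have h2 := sub_le_of_strictMono ha (i := i) (j := ⟨p - 1, by omega⟩)
      (Fin.le_def.mpr (by simp; omega))
    have h3 := (hcon ⟨0, hp⟩).1
    have h4 := (hcon ⟨p - 1, by omega⟩).2
    simp only [Nat.cast_zero] at h1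
    push_cast [Nat.cast_sub hp] at h2
    omega
  obtain ⟨i, hi⟩ := hout
  rw [starFormula, Finset.prod_eq_zero (Finset.mem_univ i), zero_mul]
  rcases hi with hi | hi
  · rw [invFact_of_neg hi]; ring
  · rw [invFact_of_neg (k := ((0 : ℕ) : ℤ) + p - 1 - a i) (by push_cast; omega)]; ring

/-- Stars of length `m` whose `i`-th branch ends at `2 * a i - m`. -/
def StarEnd (p m : ℕ) (a : Fin p → ℤ) : Type :=
  {w : Fin p → ℕ → ℤ // IsStarNW p m w ∧ ∀ i, w i m = 2 * a i - m}

lemma StarEnd.strictMono {p m : ℕ} {a : Fin p → ℤ} (w : StarEnd p m a) : StrictMono a := by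
  obtain ⟨w, ⟨-, -, h, -⟩, he⟩ := w
  intro i j hij
  have := h i j hij m le_rfl
  rw [he, he] at this
  omega

/-- Appending a last step to a star, down exactly for the branches outside of `s`. -/
def starExtend {p m : ℕ} {a : Fin p → ℤ} (ha : StrictMono a)
    (x : Σ s : Finset (Fin p), StarEnd p m fun i => a i - if i ∈ s then 1 else 0) :
    StarEnd p (m + 1) a :=
  ⟨fun i k => if k = m + 1 then 2 * a i - (m + 1) else x.2.1 i k, by
    obtain ⟨s, w, ⟨h0, hstep, hlt, hz⟩, he⟩ := x
    refine ⟨⟨fun i => ?_, fun i k hk => ?_, fun i j hij k hk => ?_, fun i k hk => ?_⟩,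
      fun i => ?_⟩
    · simpa using h0 i
    · rcases (by omega : k = m ∨ k < m) with rfl | hk
      · have := he i
        dsimp only at this
        simp only [if_true, if_neg (show k ≠ k + 1 by omega)]
        split_ifs at this <;> omega
      · have := hstep i k hk
        simpa [show k ≠ m by omega, show k ≠ m + 1 by omega] using this
    · rcases (by omega : k = m + 1 ∨ k ≤ m) with rfl | hk
      · have := ha hij
        simp only [if_true]
        omega
      · simpa [show k ≠ m + 1 by omega] using hlt i j hij k hk
    · simpa [show k ≠ m + 1 by omega] using hz i k (by omega)
    · simp⟩

lemma starExtend_bijective {p m : ℕ} {a : Fin p → ℤ} (ha : StrictMono a) :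
    Function.Bijective (starExtend (m := m) ha) := by
  constructor
  · rintro ⟨s, w, ⟨h0, hstep, hlt, hz⟩, he⟩ ⟨s', w', ⟨h0', hstep', hlt', hz'⟩, he'⟩ h
    have hw : ∀ i k, k ≠ m + 1 → w i k = w' i k := by
      intro i k hk
      have := congrFun (congrFun (congrArg Subtype.val h) i) k
      simpa [starExtend, hk] using this
    have hww : w = w' := by
      ext i k
      by_cases hk : k = m + 1
      · rw [hz i k (by omega), hz' i k (by omega)]
      · exact hw i k hk
    subst hww
    have hs : s = s' := by
      ext i
      have h1 := he i
      have h2 := he' i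
      by_cases hi : i ∈ s <;> by_cases hi' : i ∈ s' <;> simp [hi, hi'] at h1 h2 ⊢ <;> omega
    subst hs
    rfl
  · rintro ⟨w, ⟨h0, hstep, hlt, hz⟩, he⟩
    refine ⟨⟨Finset.univ.filter fun i => w i (m + 1) - w i m = 1,
      fun i k => if k ≤ m then w i k else 0,
      ⟨fun i => ?_, fun i k hk => ?_, fun i j hij k hk => ?_, fun i k hk => ?_⟩, fun i => ?_⟩, ?_⟩
    · simpa using h0 i
    · simpa [hk.le, Nat.succ_le_of_lt hk] using hstep i k (by omega)
    · simpa [hk] using hlt i j hij k (by omega)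
    · simp [show ¬ k ≤ m by omega]
    · have h1 := he i
      have h2 := hstep i m (by omega)
      simp only [le_refl, if_true, Finset.mem_filter, Finset.mem_univ, true_and]
      push_cast at h1
      split_ifs <;> omega
    · apply Subtype.ext
      ext i k
      simp only [starExtend]
      split_ifs with h1 h2
      · rw [h1, he]; push_cast; ring
      · rfl
      · rw [hz i k (by omega)]

lemma card_starEnd_zero {p : ℕ} (hp : 1 ≤ p) {a : Fin p → ℤ} (ha : StrictMono a) :
    Finite (StarEnd p 0 a) ∧ (Nat.card (StarEnd p 0 a) : ℝ) = starFormula p 0 a := by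
  by_cases hid : a = fun i : Fin p => ((i : ℕ) : ℤ)
  · have hs : Subsingleton (StarEnd p 0 a) := by
      constructor
      rintro ⟨w, ⟨h0, -, -, hz⟩, -⟩ ⟨w', ⟨h0', -, -, hz'⟩, -⟩
      apply Subtype.ext
      ext i k
      rcases Nat.eq_zero_or_pos k with rfl | hk
      · exact (h0 i).trans (h0' i).symm
      · exact (hz i k hk).trans (hz' i k hk).symm
    have hn : Nonempty (StarEnd p 0 a) := by
      refine ⟨⟨fun i k => if k = 0 then 2 * ((i : ℕ) : ℤ) else 0,
        ⟨fun i => by simp, fun i k hk => by omega, fun i j hij k hk => ?_, fun i k hk => ?_⟩,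
        fun i => by simp [hid]⟩⟩
      · have : (i : ℕ) < j := hij
        simp only [show k = 0 by omega, if_true]
        omega
      · simp [show k ≠ 0 by omega]
    refine ⟨inferInstance, ?_⟩
    rw [Nat.card_eq_one_iff_unique.mpr ⟨hs, hn⟩, hid, starFormula_zero_val hp, Nat.cast_one]
  · have : IsEmpty (StarEnd p 0 a) := by
      constructor
      rintro ⟨w, ⟨h0, -⟩, he⟩
      apply hid
      ext i
      have h1 := h0 i
      have h2 := he i
      push_cast at h2
      omega
    refine ⟨inferInstance, ?_⟩
    rw [Nat.card_of_isEmpty, starFormula_zero_of_ne hp ha hid, Nat.cast_zero]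

/-- Stars with prescribed endpoints are counted by the product formula. -/
theorem card_starEnd {p : ℕ} (hp : 1 ≤ p) (m : ℕ) (a : Fin p → ℤ) (ha : Monotone a) :
    Finite (StarEnd p m a) ∧ (Nat.card (StarEnd p m a) : ℝ) = starFormula p m a := by
  induction m generalizing a with
  | zero =>
    by_cases hinj : Function.Injective a
    · exact card_starEnd_zero hp (ha.strictMono_of_injective hinj)
    · have : IsEmpty (StarEnd p 0 a) := ⟨fun w => hinj w.strictMono.injective⟩
      exact ⟨inferInstance, by rw [Nat.card_of_isEmpty, starFormula_eq_zero hinj, Nat.cast_zero]⟩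
  | succ m ih =>
    by_cases hinj : Function.Injective a
    · have hs := ha.strictMono_of_injective hinj
      have hmono : ∀ s : Finset (Fin p), Monotone fun i => a i - if i ∈ s then 1 else 0 := by
        intro s i j hij
        rcases hij.eq_or_lt with rfl | hij
        · rfl
        · have := hs hij
          dsimp only
          split_ifs <;> omega
      have hfin : ∀ s : Finset (Fin p),
          Finite (StarEnd p m fun i => a i - if i ∈ s then 1 else 0) := fun s => (ih _ (hmono s)).1
      let e := Equiv.ofBijective _ (starExtend_bijective (m := m) hs)
      refine ⟨Finite.of_equiv _ e, ?_⟩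
      rw [← Nat.card_congr e, Nat.card_sigma, Nat.cast_sum, starFormula_succ]
      exact Finset.sum_congr rfl fun s _ => (ih _ (hmono s)).2
    · have : IsEmpty (StarEnd p (m + 1) a) := ⟨fun w => hinj w.strictMono.injective⟩
      exact ⟨inferInstance, by rw [Nat.card_of_isEmpty, starFormula_eq_zero hinj, Nat.cast_zero]⟩

lemma card_melon {p : ℕ} (hp : 1 ≤ p) (n : ℕ) :
    (Nat.card {w : Fin p → ℕ → ℤ // IsMelonNW p n w} : ℝ) =
      starFormula p (2 * n) fun i => (n : ℤ) + (i : ℕ) := by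
  rw [← (card_starEnd hp (2 * n) (fun i : Fin p => (n : ℤ) + (i : ℕ)) ?_).2]
  · congr 1
    refine Nat.card_congr (Equiv.subtypeEquivRight fun w => and_congr_right fun _ =>
      forall_congr' fun i => ?_)
    rw [show 2 * ((n : ℤ) + (i : ℕ)) - (2 * n : ℕ) = 2 * ((i : ℕ) : ℤ) by push_cast; ring]
  · intro i j hij
    have : (i : ℕ) ≤ j := hij
    dsimp only
    omega

/-- A watermelon cut at time `m` is a pair of stars, the second one run backwards. -/
def melonSplit {p n m m' : ℕ} (hm : m + m' = 2 * n) {z a a' : Fin p → ℤ}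
    (ha : ∀ i, z i = 2 * a i - m) (ha' : ∀ i, z i = 2 * a' i - m') :
    {w : Fin p → ℕ → ℤ // IsMelonNW p n w ∧ ∀ i, w i m = z i} ≃
      StarEnd p m a × StarEnd p m' a' where
  toFun w :=
    (⟨fun i k => if k ≤ m then w.1 i k else 0, by
      obtain ⟨w, ⟨⟨h0, hstep, hlt, hz⟩, hend⟩, he⟩ := w
      refine ⟨⟨fun i => ?_, fun i k hk => ?_, fun i j hij k hk => ?_, fun i k hk => ?_⟩,
        fun i => ?_⟩
      · simpa using h0 i
      · simpa [hk.le, Nat.succ_le_of_lt hk] using hstep i k (by omega)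
      · simpa [hk] using hlt i j hij k (by omega)
      · simp [show ¬ k ≤ m by omega]
      · simpa [← ha] using he i⟩,
    ⟨fun i k => if k ≤ m' then w.1 i (2 * n - k) else 0, by
      obtain ⟨w, ⟨⟨h0, hstep, hlt, hz⟩, hend⟩, he⟩ := w
      refine ⟨⟨fun i => ?_, fun i k hk => ?_, fun i j hij k hk => ?_, fun i k hk => ?_⟩,
        fun i => ?_⟩
      · simpa using hend i
      · have h := hstep i (2 * n - (k + 1)) (by omega)
        rw [show 2 * n - (k + 1) + 1 = 2 * n - k by omega] at h
        simp only [hk.le, Nat.succ_le_of_lt hk, if_true]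
        omega
      · simpa [hk] using hlt i j hij (2 * n - k) (by omega)
      · simp [show ¬ k ≤ m' by omega]
      · simpa [← ha', show 2 * n - m' = m by omega] using he i⟩)
  invFun x :=
    ⟨fun i k => if k ≤ m then x.1.1 i k else if k ≤ 2 * n then x.2.1 i (2 * n - k) else 0, by
      obtain ⟨⟨u, ⟨h0, hstep, hlt, hz⟩, he⟩, ⟨v, ⟨h0', hstep', hlt', hz'⟩, he'⟩⟩ := x
      have hglue : ∀ i, u i m = v i m' := fun i => by rw [he, he', ← ha, ← ha']
      refine ⟨⟨⟨fun i => ?_, fun i k hk => ?_, fun i j hij k hk => ?_, fun i k hk => ?_⟩,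
        fun i => ?_⟩, fun i => ?_⟩
      · simpa using h0 i
      · rcases (by omega : k < m ∨ m ≤ k) with hkm | hkm
        · simpa [hkm.le, Nat.succ_le_of_lt hkm] using hstep i k hkm
        · have h := hstep' i (2 * n - (k + 1)) (by omega)
          rw [show 2 * n - (k + 1) + 1 = 2 * n - k by omega] at h
          simp only [show ¬ k + 1 ≤ m by omega, if_false, show k + 1 ≤ 2 * n by omega, if_true]
          rcases hkm.eq_or_lt with rfl | hkm
          · rw [show 2 * n - m = m' by omega] at h
            simp only [le_refl, if_true, hglue]
            omega
          · simp only [show ¬ k ≤ m by omega, if_false, show k ≤ 2 * n by omega, if_true]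
            omega
      · dsimp only
        split_ifs with hkm
        · exact hlt i j hij k hkm
        · exact hlt' i j hij _ (by omega)
      · simp [show ¬ k ≤ m by omega, show ¬ k ≤ 2 * n by omega]
      · by_cases h : 2 * n ≤ m
        · obtain rfl : m' = 0 := by omega
          obtain rfl : m = 2 * n := by omega
          simpa [hglue] using h0' i
        · simpa [h] using h0' i
      · simpa [ha] using he i⟩
  left_inv := by
    rintro ⟨w, ⟨⟨h0, hstep, hlt, hz⟩, hend⟩, he⟩
    apply Subtype.ext
    ext i k
    dsimp only
    split_ifs with h1 h2 h3
    · rfl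
    · rw [show 2 * n - (2 * n - k) = k by omega]
    · omega
    · rw [hz i k (by omega)]
  right_inv := by
    rintro ⟨⟨u, ⟨h0, hstep, hlt, hz⟩, he⟩, ⟨v, ⟨h0', hstep', hlt', hz'⟩, he'⟩⟩
    refine Prod.ext (Subtype.ext ?_) (Subtype.ext ?_)
    · ext i k
      dsimp only
      split_ifs with h1
      · rfl
      · rw [hz i k (by omega)]
    · ext i k
      dsimp only
      split_ifs with h1 h2 h3
      · obtain rfl : k = m' := by omega
        rw [show 2 * n - k = m by omega, he, he', ← ha, ← ha']
      · rw [show 2 * n - (2 * n - k) = k by omega]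
      · omega
      · rw [hz' i k (by omega)]

lemma probNW_eq {p : ℕ} (hp : 1 ≤ p) {n m m' : ℕ} (hm : m + m' = 2 * n) {z a a' : Fin p → ℤ}
    (hz : StrictMono z) (ha : ∀ i, z i = 2 * a i - m) (ha' : ∀ i, z i = 2 * a' i - m') :
    probNW p n (fun w => ∀ i, w i m = z i) =
      starFormula p m a * starFormula p m' a' /
        starFormula p (2 * n) fun i => (n : ℤ) + (i : ℕ) := by
  have hmono : Monotone a := fun i j hij => by
    have := hz.monotone hij
    rw [ha i, ha j] at this
    omega
  have hmono' : Monotone a' := fun i j hij => by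
    have := hz.monotone hij
    rw [ha' i, ha' j] at this
    omega
  rw [probNW, card_melon hp, Nat.card_congr (melonSplit hm ha ha'), Nat.card_prod, Nat.cast_mul,
    (card_starEnd hp m a hmono).2, (card_starEnd hp m' a' hmono').2]

lemma abs_log_factorial_sub_stirling_le {N : ℕ} (hN : 1 ≤ N) :
    |Real.log (N.factorial : ℝ) - ((N + 1 / 2) * Real.log N - N + 1 / 2 * Real.log (2 * Real.pi))|
      ≤ 1 / N := by
  have hN0 : (0 : ℝ) < N := by exact_mod_cast hN
  have hlow := Stirling.le_log_factorial_stirling (n := N) (by omega)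
  have hmono : Monotone fun k : ℕ =>
      Real.log (Stirling.stirlingSeq (k + 1)) - 1 / (12 * ((k : ℝ) + 1)) := by
    refine monotone_nat_of_le_succ fun k => ?_
    have h := Stirling.log_stirlingSeq_sdiff_le (k + 1)
    have he : (1 : ℝ) / (12 * ((k : ℝ) + 1)) - 1 / (12 * (((k + 1 : ℕ) : ℝ) + 1)) =
        1 / (12 * ((k + 1 : ℕ) : ℝ) * (((k + 1 : ℕ) : ℝ) + 1)) := by
      push_cast
      field_simp
      ring
    linarith
  have hlim : Tendsto (fun k : ℕ =>
      Real.log (Stirling.stirlingSeq (k + 1)) - 1 / (12 * ((k : ℝ) + 1))) atTop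
      (nhds (Real.log (√Real.pi) - 0)) := by
    refine Tendsto.sub ?_ ?_
    · exact ((Stirling.tendsto_stirlingSeq_sqrt_pi.comp (tendsto_add_atTop_nat 1))).log
        (by positivity)
    · have := (tendsto_one_div_add_atTop_nhds_zero_nat (𝕜 := ℝ)).const_mul (1 / 12)
      rw [mul_zero] at this
      refine this.congr fun k => ?_
      field_simp
  have hup := hmono.ge_of_tendsto hlim (N - 1)
  simp only [Nat.sub_add_cancel hN, Nat.cast_sub hN, Nat.cast_one, sub_add_cancel] at hup
  rw [Stirling.log_stirlingSeq_formula, Real.log_sqrt Real.pi_pos.le,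
    Real.log_mul two_ne_zero hN0.ne', Real.log_div hN0.ne' (Real.exp_ne_zero _),
    Real.log_exp] at hup
  rw [Real.log_mul two_ne_zero Real.pi_ne_zero] at hlow ⊢
  have h12 : 1 / (12 * (N : ℝ)) ≤ 1 / N :=
    one_div_le_one_div_of_le hN0 (by linarith)
  have : 0 ≤ 1 / (N : ℝ) := by positivity
  rw [abs_le]
  constructor <;> linarith

set_option maxHeartbeats 1000000 in
/-- Second-order Stirling expansion around `c * s ^ 2` with a displacement of order `s`. -/
lemma log_factorial_expansion (c Q B : ℝ) (hc : 0 < c) (hQ : 0 ≤ Q) (hB : 0 ≤ B) :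
    ∃ C > (0 : ℝ), ∃ S > (0 : ℝ), ∀ s : ℝ, S ≤ s → ∀ q : ℝ, |q| ≤ Q → ∀ y : ℕ,
      |(y : ℝ) - c * s ^ 2 - q * s| ≤ B →
      |Real.log (y.factorial : ℝ) - ((y + 1 / 2) * Real.log (c * s ^ 2) - c * s ^ 2 +
        q ^ 2 / (2 * c) + 1 / 2 * Real.log (2 * Real.pi))| ≤ C / s := by
  set D := Q + B with hD
  have hD0 : 0 ≤ D := by positivity
  refine ⟨(2 * Q * B + B ^ 2) / (2 * c) + 4 * D ^ 3 / c ^ 2 + D / c + 2 / c, by positivity,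
    max 1 (max (2 * D / c) (2 / c)), by positivity, ?_⟩
  intro s hs q hq y hy
  have hs1 : 1 ≤ s := (le_max_left _ _).trans hs
  have hs2 : 2 * D / c ≤ s := ((le_max_left _ _).trans (le_max_right _ _)).trans hs
  have hs3 : 2 / c ≤ s := ((le_max_right _ _).trans (le_max_right _ _)).trans hs
  have hs0 : 0 < s := by linarith
  set β := (y : ℝ) - c * s ^ 2 - q * s with hβ
  set μ := c * s ^ 2 with hμ
  have hμ0 : 0 < μ := by positivity
  set r := ((y : ℝ) - μ) / μ with hr
  have hyr : (y : ℝ) = μ * (1 + r) := by rw [hr]; field_simp; ring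
  have hd : (y : ℝ) - μ = q * s + β := by rw [hβ]; ring
  have hdabs : |(y : ℝ) - μ| ≤ D * s := by
    rw [hd]
    calc |q * s + β| ≤ |q * s| + |β| := abs_add_le _ _
      _ = |q| * s + |β| := by rw [abs_mul, abs_of_pos hs0]
      _ ≤ Q * s + B * s := by nlinarith
      _ = D * s := by rw [hD]; ring
  have hrabs : |r| ≤ D / (c * s) := by
    rw [hr, abs_div, abs_of_pos hμ0, div_le_div_iff₀ hμ0 (by positivity), hμ]
    calc _ ≤ D * s * (c * s) := by gcongr
      _ = _ := by ring
  have hrhalf : |r| ≤ 1 / 2 := by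
    refine hrabs.trans ?_
    rw [div_le_iff₀ (by positivity)]
    rw [div_le_iff₀ hc] at hs2
    linarith
  have hrl := (abs_le.mp hrhalf).1
  have hru := (abs_le.mp hrhalf).2
  have hyhalf : μ / 2 ≤ y := by rw [hyr]; nlinarith
  have hy1 : 1 ≤ y := by
    have : (0 : ℝ) < y := by linarith
    exact_mod_cast this
  have hlog : Real.log y = Real.log μ + Real.log (1 + r) := by
    rw [hyr, Real.log_mul hμ0.ne' (by linarith)]
  set l := Real.log (1 + r) with hl
  have hl2 : |l - (r - r ^ 2 / 2)| ≤ 2 * |r| ^ 3 := by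
    have h := Real.abs_log_sub_add_sum_range_le (x := -r) (by rw [abs_neg]; linarith) 2
    simp only [Finset.sum_range_succ, Finset.sum_range_zero, abs_neg, sub_neg_eq_add] at h
    rw [← hl] at h
    norm_num at h
    refine le_trans (le_of_eq ?_) (h.trans ?_)
    · congr 1; ring
    · rw [div_le_iff₀ (by linarith)]
      have : 0 ≤ |r| ^ 3 := by positivity
      nlinarith
  have hl1 : |l| ≤ 2 * |r| := by
    have h := Real.abs_log_sub_add_sum_range_le (x := -r) (by rw [abs_neg]; linarith) 0
    simp only [Finset.sum_range_zero, abs_neg, sub_neg_eq_add] at h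
    rw [← hl] at h
    norm_num at h
    refine h.trans ?_
    rw [div_le_iff₀ (by linarith)]
    nlinarith [abs_nonneg r]
  have hst := abs_log_factorial_sub_stirling_le hy1
  rw [hlog] at hst
  set ε := Real.log (y.factorial : ℝ) - ((y + 1 / 2) * (Real.log μ + l) - y +
    1 / 2 * Real.log (2 * Real.pi)) with hε
  set e := l - (r - r ^ 2 / 2) with he
  have hmain : Real.log (y.factorial : ℝ) - ((y + 1 / 2) * Real.log μ - μ +
        q ^ 2 / (2 * c) + 1 / 2 * Real.log (2 * Real.pi)) =
      (2 * q * β * s + β ^ 2) / (2 * μ) + μ * (-r ^ 3 / 2 + (1 + r) * e) + l / 2 + ε := by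
    have h1 : (2 * q * β * s + β ^ 2) / (2 * μ) = μ * r ^ 2 / 2 - q ^ 2 / (2 * c) := by
      have : μ * r = q * s + β := by rw [hr, ← hd]; field_simp
      have h2 : μ * r ^ 2 = (q * s + β) ^ 2 / μ := by rw [← this]; field_simp
      rw [h2, hμ]
      field_simp
      ring
    have h2 : (y : ℝ) * l = μ * (1 + r) * (r - r ^ 2 / 2 + e) := by rw [hyr, he]; ring
    rw [h1, hε]
    linear_combination h2 - hyr
  rw [hmain]
  have b1 : |(2 * q * β * s + β ^ 2) / (2 * μ)| ≤ (2 * Q * B + B ^ 2) / (2 * c) / s := by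
    rw [abs_div, abs_of_pos (by positivity : 0 < 2 * μ), div_div,
      div_le_div_iff₀ (by positivity) (by positivity)]
    have : |2 * q * β * s + β ^ 2| ≤ (2 * Q * B + B ^ 2) * s := by
      calc _ ≤ |2 * q * β * s| + |β ^ 2| := abs_add_le _ _
        _ = 2 * |q| * |β| * s + |β| ^ 2 := by
          rw [abs_mul, abs_mul, abs_mul, abs_of_pos hs0, abs_pow]; norm_num
        _ ≤ 2 * Q * B * s + B ^ 2 * s := by
          gcongr
          calc |β| ^ 2 ≤ B ^ 2 := by gcongr
            _ ≤ B ^ 2 * s := by nlinarith [sq_nonneg B]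
        _ = _ := by ring
    calc _ ≤ (2 * Q * B + B ^ 2) * s * (2 * c * s) := by gcongr
      _ = _ := by rw [hμ]; ring
  have b2 : |μ * (-r ^ 3 / 2 + (1 + r) * e)| ≤ 4 * D ^ 3 / c ^ 2 / s := by
    rw [abs_mul, abs_of_pos hμ0]
    have h1 : |-r ^ 3 / 2 + (1 + r) * e| ≤ 4 * |r| ^ 3 := by
      calc _ ≤ |-r ^ 3 / 2| + |(1 + r) * e| := abs_add_le _ _
        _ = |r| ^ 3 / 2 + (1 + r) * |e| := by
          rw [abs_div, abs_neg, abs_pow, abs_mul, abs_of_pos (by linarith : 0 < 1 + r)]; norm_num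
        _ ≤ |r| ^ 3 / 2 + (3 / 2) * (2 * |r| ^ 3) := by
          gcongr
          linarith
        _ ≤ _ := by nlinarith [pow_nonneg (abs_nonneg r) 3]
    calc _ ≤ μ * (4 * (D / (c * s)) ^ 3) := by
          gcongr
          exact h1.trans (by gcongr)
      _ = _ := by rw [hμ]; field_simp
  have b3 : |l / 2| ≤ D / c / s := by
    rw [abs_div, abs_two, div_div]
    linarith
  have b4 : |ε| ≤ 2 / c / s := by
    refine hst.trans ?_
    have : (y : ℝ) ≥ c * s / 2 := by
      refine le_trans ?_ hyhalf
      rw [hμ]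
      nlinarith [mul_pos hc hs0]
    rw [div_div, div_le_div_iff₀ (by linarith) (by positivity)]
    linarith
  calc _ ≤ |(2 * q * β * s + β ^ 2) / (2 * μ)| + |μ * (-r ^ 3 / 2 + (1 + r) * e)| + |l / 2| +
        |ε| := by
        refine (abs_add_le _ _).trans ?_
        gcongr
        refine (abs_add_le _ _).trans ?_
        gcongr
        exact abs_add_le _ _
    _ ≤ (2 * Q * B + B ^ 2) / (2 * c) / s + 4 * D ^ 3 / c ^ 2 / s + D / c / s + 2 / c / s := by
        gcongr
    _ = _ := by ring

lemma abs_le_of_eq_signed_sum {T e1 e2 e3 e4 e5 e6 e7 e8 e9 c1 c2 c3 c4 c5 c6 c7 c8 c9 : ℝ}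
    (h1 : |e1| ≤ c1) (h2 : |e2| ≤ c2) (h3 : |e3| ≤ c3) (h4 : |e4| ≤ c4) (h5 : |e5| ≤ c5)
    (h6 : |e6| ≤ c6) (h7 : |e7| ≤ c7) (h8 : |e8| ≤ c8) (h9 : |e9| ≤ c9)
    (hT : T = e1 + e2 - e3 - e4 - e5 - e6 - e7 + e8 + e9) :
    |T| ≤ c1 + c2 + c3 + c4 + c5 + c6 + c7 + c8 + c9 := by
  rw [abs_le] at *
  constructor <;> linarith

set_option maxHeartbeats 1000000 in
/-- Expansion of the factorials contributed by one branch of a watermelon. -/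
lemma branch_factorials_expansion (p : ℕ) (t : ℝ) (ht0 : 0 < t) (ht1 : t < 1) (R : ℝ)
    (hR : 0 ≤ R) :
    ∃ C > (0 : ℝ), ∃ S > (0 : ℝ), ∀ n : ℕ, S ≤ √(n : ℝ) → ∀ i < p, ∀ x : ℝ, |x| ≤ R →
      ∀ m m' a b a' b' : ℕ, m + m' = 2 * n → |(m : ℝ) - 2 * n * t| ≤ 1 →
      (2 * a : ℝ) = m + x * √(2 * n) → a + b + 1 = m + p →
      (2 * a' : ℝ) = m' + x * √(2 * n) → a' + b' + 1 = m' + p →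
      |(Real.log (m + i).factorial - Real.log a.factorial - Real.log b.factorial)
        + (Real.log (m' + i).factorial - Real.log a'.factorial - Real.log b'.factorial)
        - (Real.log (2 * n + i).factorial - Real.log (n + i).factorial
            - Real.log (n + (p - 1 - i)).factorial)
        - ((i + 1 / 2 - p) * (Real.log t + Real.log (1 - t) + Real.log n)
            + (i + 1 / 2) * Real.log 2 - x ^ 2 / (2 * t * (1 - t))
            - 1 / 2 * (Real.log 2 + Real.log Real.pi))| ≤ C / √(n : ℝ) := by
  have ht1' : 0 < 1 - t := by linarith
  have hB : (0 : ℝ) ≤ (p : ℝ) + 2 := by positivity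
  obtain ⟨C1, hC1, S1, hS1, H1⟩ :=
    log_factorial_expansion (2 * t) R (p + 2) (by positivity) hR hB
  obtain ⟨C2, hC2, S2, hS2, H2⟩ :=
    log_factorial_expansion (2 * (1 - t)) R (p + 2) (by positivity) hR hB
  obtain ⟨C3, hC3, S3, hS3, H3⟩ := log_factorial_expansion 2 R (p + 2) (by positivity) hR hB
  obtain ⟨C4, hC4, S4, hS4, H4⟩ := log_factorial_expansion t R (p + 2) ht0 hR hB
  obtain ⟨C5, hC5, S5, hS5, H5⟩ := log_factorial_expansion (1 - t) R (p + 2) ht1' hR hB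
  obtain ⟨C6, hC6, S6, hS6, H6⟩ := log_factorial_expansion 1 R (p + 2) one_pos hR hB
  refine ⟨C1 + C2 + C3 + 2 * C4 + 2 * C5 + 2 * C6, by positivity,
    S1 + S2 + S3 + S4 + S5 + S6, by positivity, ?_⟩
  intro n hn i hi x hx m m' a b a' b' hmm hmt ha hab ha' hab'
  set s := √(n : ℝ) with hs
  have hs0 : 0 < s := by linarith
  have hsn : s ^ 2 = n := Real.sq_sqrt (Nat.cast_nonneg n)
  have hn0 : (0 : ℝ) < n := by rw [← hsn]; positivity
  have hip : (i : ℝ) + 1 ≤ p := by exact_mod_cast hi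
  have hi0 : (0 : ℝ) ≤ i := Nat.cast_nonneg i
  have hmmR : (m : ℝ) + m' = 2 * n := by exact_mod_cast hmm
  have habR : (a : ℝ) + b + 1 = m + p := by exact_mod_cast hab
  have habR' : (a' : ℝ) + b' + 1 = m' + p := by exact_mod_cast hab'
  have hrev : ((n + (p - 1 - i) : ℕ) : ℝ) = n + (p - 1 - i) := by
    rw [Nat.cast_add, Nat.cast_sub (by omega), Nat.cast_sub (by omega)]; norm_num
  obtain ⟨hm1, hm2⟩ := abs_le.mp hmt
  set q := x / √2 with hq
  have h2 : √(2 : ℝ) ^ 2 = 2 := Real.sq_sqrt (by norm_num)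
  have h20 : 0 < √(2 : ℝ) := by positivity
  have hq2 : q ^ 2 = x ^ 2 / 2 := by rw [hq, div_pow, h2]
  have hxq : x * √(2 * n) = 2 * (q * s) := by
    rw [Real.sqrt_mul (by norm_num), hq, ← hs]
    field_simp
    rw [h2]
  have hqR : |q| ≤ R := by
    refine le_trans ?_ hx
    rw [hq, abs_div, abs_of_pos h20]
    exact div_le_self (abs_nonneg x) (Real.one_le_sqrt.mpr (by norm_num))
  have h0R : |(0 : ℝ)| ≤ R := by simpa using hR
  have hnqR : |(-q)| ≤ R := by rwa [abs_neg]
  rw [hxq] at ha ha'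
  have e1 := H1 s (by linarith) 0 h0R (m + i) (by
    rw [abs_le, hsn]; push_cast; constructor <;> linarith)
  have e2 := H2 s (by linarith) 0 h0R (m' + i) (by
    rw [abs_le, hsn]; push_cast; constructor <;> linarith)
  have e3 := H3 s (by linarith) 0 h0R (2 * n + i) (by
    rw [abs_le, hsn]; push_cast; constructor <;> linarith)
  have e4 := H4 s (by linarith) q hqR a (by
    rw [abs_le, hsn]; constructor <;> linarith)
  have e5 := H4 s (by linarith) (-q) hnqR b (by
    rw [abs_le, hsn]; constructor <;> linarith)
  have e6 := H5 s (by linarith) q hqR a' (by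
    rw [abs_le, hsn]; constructor <;> linarith)
  have e7 := H5 s (by linarith) (-q) hnqR b' (by
    rw [abs_le, hsn]; constructor <;> linarith)
  have e8 := H6 s (by linarith) 0 h0R (n + i) (by
    rw [abs_le, hsn]; push_cast; constructor <;> linarith)
  have e9 := H6 s (by linarith) 0 h0R (n + (p - 1 - i)) (by
    rw [abs_le, hsn, hrev]; constructor <;> linarith)
  rw [hrev] at e9
  push_cast at e1 e2 e3 e8
  have hl2n : Real.log (2 * (n : ℝ)) = Real.log 2 + Real.log n := Real.log_mul (by norm_num) hn0.ne'
  have hltn : Real.log (t * (n : ℝ)) = Real.log t + Real.log n := Real.log_mul ht0.ne' hn0.ne'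
  have hl1n : Real.log ((1 - t) * (n : ℝ)) = Real.log (1 - t) + Real.log n :=
    Real.log_mul ht1'.ne' hn0.ne'
  have hl2tn : Real.log (2 * t * (n : ℝ)) = Real.log 2 + (Real.log t + Real.log n) := by
    rw [mul_assoc, Real.log_mul (by norm_num) (by positivity), hltn]
  have hl21n : Real.log (2 * (1 - t) * (n : ℝ)) = Real.log 2 + (Real.log (1 - t) + Real.log n) := by
    rw [mul_assoc, Real.log_mul (by norm_num) (by positivity), hl1n]
  have hl2pi : Real.log (2 * Real.pi) = Real.log 2 + Real.log Real.pi :=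
    Real.log_mul (by norm_num) Real.pi_ne_zero
  simp only [hsn, hl2n, hltn, hl1n, hl2tn, hl21n, hl2pi, one_mul, neg_sq, hq2]
    at e1 e2 e3 e4 e5 e6 e7 e8 e9
  have hx2 : x ^ 2 / (2 * t * (1 - t)) =
      x ^ 2 / 2 / (2 * t) * 2 + x ^ 2 / 2 / (2 * (1 - t)) * 2 := by
    field_simp
    ring
  rw [hx2]
  have hsplit : (C1 + C2 + C3 + 2 * C4 + 2 * C5 + 2 * C6) / s =
      C1 / s + C2 / s + C3 / s + 2 * (C4 / s) + 2 * (C5 / s) + 2 * (C6 / s) := by ring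
  have hb : (b : ℝ) = m + p - 1 - a := by linarith
  have hb' : (b' : ℝ) = (2 * n - m) + p - 1 - a' := by linarith
  have hm' : (m' : ℝ) = 2 * n - m := by linarith
  rw [hb] at e5
  rw [hb'] at e7
  rw [hm'] at e2
  rw [hsplit]
  refine (abs_le_of_eq_signed_sum e1 e2 e3 e4 e5 e6 e7 e8 e9 ?_).trans (le_of_eq ?_)
  · ring
  · ring

lemma det_vandermonde_pos {p : ℕ} {v : Fin p → ℝ} (hv : StrictMono v) :
    0 < (Matrix.vandermonde v).det := by
  rw [Matrix.det_vandermonde]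
  exact Finset.prod_pos fun i _ => Finset.prod_pos fun j hj =>
    sub_pos.mpr (hv (Finset.mem_Ioi.mp hj))

lemma log_det_vandermonde {p : ℕ} {v : Fin p → ℝ} (hv : StrictMono v) :
    Real.log (Matrix.vandermonde v).det =
      ∑ i : Fin p, ∑ j ∈ Finset.Ioi i, Real.log (v j - v i) := by
  have hne : ∀ i : Fin p, ∀ j ∈ Finset.Ioi i, v j - v i ≠ 0 := fun i j hj =>
    (sub_pos.mpr (hv (Finset.mem_Ioi.mp hj))).ne'
  rw [Matrix.det_vandermonde, Real.log_prod fun i _ => Finset.prod_ne_zero_iff.mpr (hne i)]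
  exact Finset.sum_congr rfl fun i _ => Real.log_prod (hne i)

lemma sum_fin_cast (p : ℕ) : ∑ i : Fin p, ((i : ℕ) : ℝ) = p * (p - 1) / 2 := by
  rw [Fin.sum_univ_eq_sum_range (fun i => (i : ℝ)) p]
  induction p with
  | zero => simp
  | succ p ih => rw [Finset.sum_range_succ, ih]; push_cast; ring

lemma sum_card_Ioi (p : ℕ) : ∑ i : Fin p, ((Finset.Ioi i).card : ℝ) = p * (p - 1) / 2 := by
  rw [← sum_fin_cast, ← Equiv.sum_comp Fin.revPerm]
  refine Finset.sum_congr rfl fun i _ => ?_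
  rw [Fin.card_Ioi, Fin.revPerm_apply, Fin.val_rev]
  congr 1
  omega

lemma log_starFormula {p m : ℕ} {a b : Fin p → ℕ} (hab : ∀ i, a i + b i + 1 = m + p)
    (ha : StrictMono fun i => (a i : ℝ)) :
    0 < starFormula p m (fun i => (a i : ℤ)) ∧
    Real.log (starFormula p m fun i => (a i : ℤ)) =
      ∑ i : Fin p, (Real.log (m + i).factorial - Real.log (a i).factorial
        - Real.log (b i).factorial) + Real.log (Matrix.vandermonde fun i => (a i : ℝ)).det := by
  have hV := det_vandermonde_pos ha
  have hform : starFormula p m (fun i => (a i : ℤ)) =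
      (∏ i : Fin p, ((m + i).factorial : ℝ) / (a i).factorial / (b i).factorial) *
        (Matrix.vandermonde fun i => (a i : ℝ)).det := by
    rw [starFormula]
    simp only [Int.cast_natCast]
    congr 1
    refine Finset.prod_congr rfl fun i _ => ?_
    rw [show (m : ℤ) + p - 1 - a i = b i by have := hab i; omega, invFact_natCast, invFact_natCast]
    rw [div_eq_mul_inv, div_eq_mul_inv]
  have hpos : ∀ i : Fin p, 0 < ((m + i).factorial : ℝ) / (a i).factorial / (b i).factorial :=
    fun i => by positivity
  have hprod : 0 < ∏ i : Fin p, ((m + i).factorial : ℝ) / (a i).factorial / (b i).factorial :=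
    Finset.prod_pos fun i _ => hpos i
  rw [hform]
  refine ⟨mul_pos hprod hV, ?_⟩
  rw [Real.log_mul hprod.ne' hV.ne', Real.log_prod fun i _ => (hpos i).ne']
  congr 1
  refine Finset.sum_congr rfl fun i _ => ?_
  rw [Real.log_div (by positivity) (by positivity), Real.log_div (by positivity) (by positivity)]

lemma log_det_vandermonde_rescale {p : ℕ} {n m : ℕ} (hn : 0 < n) {x : Fin p → ℝ}
    (hx : StrictMono x) {a : Fin p → ℕ} (ha : ∀ i, (2 * a i : ℝ) = m + x i * √(2 * n)) :
    StrictMono (fun i => (a i : ℝ)) ∧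
    Real.log (Matrix.vandermonde fun i => (a i : ℝ)).det =
      ∑ i : Fin p, ∑ j ∈ Finset.Ioi i, Real.log (x j - x i) +
        p * (p - 1) / 2 * (1 / 2 * (Real.log n - Real.log 2)) := by
  have hn0 : (0 : ℝ) < n := by exact_mod_cast hn
  have hs : 0 < √(2 * (n : ℝ)) := by positivity
  have hmono : StrictMono (fun i => (a i : ℝ)) := fun i j hij => by
    have := mul_lt_mul_of_pos_right (hx hij) hs
    have h1 := ha i
    have h2 := ha j
    dsimp only
    linarith
  refine ⟨hmono, ?_⟩
  rw [log_det_vandermonde hmono, ← sum_card_Ioi, Finset.sum_mul, ← Finset.sum_add_distrib]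
  refine Finset.sum_congr rfl fun i _ => ?_
  rw [← nsmul_eq_mul, ← Finset.sum_const, ← Finset.sum_add_distrib]
  refine Finset.sum_congr rfl fun j hj => ?_
  have hpos : 0 < x j - x i := sub_pos.mpr (hx (Finset.mem_Ioi.mp hj))
  have : (a j : ℝ) - a i = (x j - x i) * (√(2 * n) / 2) := by
    have h1 := ha i
    have h2 := ha j
    linarith
  rw [this, Real.log_mul hpos.ne' (by positivity), Real.log_div hs.ne' (by norm_num),
    Real.log_sqrt (by positivity), Real.log_mul (by norm_num) hn0.ne']
  ring

lemma log_fHat {p : ℕ} (hp : 1 ≤ p) {t : ℝ} (ht0 : 0 < t) (ht1 : t < 1) {x : Fin p → ℝ}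
    (hx : StrictMono x) :
    0 < fHat p t x ∧ Real.log (fHat p t x) =
      -(p / 2) * (Real.log 2 + Real.log Real.pi)
        - p ^ 2 / 2 * (Real.log t + Real.log (1 - t))
        - Real.log (Matrix.vandermonde fun i : Fin p => ((i : ℕ) : ℝ)).det
        + 2 * ∑ i : Fin p, ∑ j ∈ Finset.Ioi i, Real.log (x j - x i)
        - ∑ i, x i ^ 2 / (2 * t * (1 - t)) := by
  have ht1' : 0 < 1 - t := by linarith
  have hfact : (∏ i ∈ Finset.range (p - 1), (Nat.factorial (i + 1) : ℝ)) =
      (Matrix.vandermonde fun i : Fin p => ((i : ℕ) : ℝ)).det := by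
    rw [det_vandermonde_fin hp, Fin.prod_univ_eq_prod_range (fun i => ((i.factorial : ℕ) : ℝ)) p]
    obtain ⟨q, rfl⟩ : ∃ q, p = q + 1 := ⟨p - 1, by omega⟩
    rw [Finset.prod_range_succ' _ q]
    simp
  have hsq : ∏ i : Fin p, ∏ j ∈ Finset.Ioi i, (x j - x i) ^ 2 =
      (Matrix.vandermonde x).det ^ 2 := by
    rw [Matrix.det_vandermonde]
    simp only [Finset.prod_pow]
  have hidx : StrictMono fun i : Fin p => ((i : ℕ) : ℝ) := fun i j hij => by
    exact Nat.cast_lt.mpr hij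
  have hV1 := det_vandermonde_pos hidx
  have hV2 := det_vandermonde_pos hx
  have htt : 0 < t * (1 - t) := mul_pos ht0 ht1'
  rw [fHat, if_pos fun i j hij => hx.monotone hij, hfact, hsq]
  have h1 : (0 : ℝ) < 2 ^ (-(p : ℝ) / 2) := by positivity
  have h2 : 0 < Real.pi ^ (-(p : ℝ) / 2) := Real.rpow_pos_of_pos Real.pi_pos _
  have h3 : 0 < (t * (1 - t)) ^ (-((p : ℝ) ^ 2 / 2)) := Real.rpow_pos_of_pos htt _
  refine ⟨by positivity, ?_⟩
  rw [Real.log_mul (by positivity) (Real.exp_ne_zero _),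
    Real.log_mul (by positivity) (by positivity),
    Real.log_mul (by positivity) (by positivity), Real.log_mul (by positivity) (by positivity),
    Real.log_mul (by positivity) (by positivity), Real.log_exp, Real.log_inv, Real.log_pow,
    Real.log_rpow two_pos, Real.log_rpow Real.pi_pos, Real.log_rpow htt,
    Real.log_mul ht0.ne' ht1'.ne', log_det_vandermonde hx, ← Finset.sum_div]
  push_cast
  ring

/-- Expansion of the logarithm of the exact one-time marginal of a watermelon. -/
lemma log_starFormula_ratio {p : ℕ} (hp : 1 ≤ p) {t : ℝ} (ht0 : 0 < t) (ht1 : t < 1) {R : ℝ}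
    (hR : 0 ≤ R) :
    ∃ C > (0 : ℝ), ∃ S > (0 : ℝ), ∀ n : ℕ, S ≤ √(n : ℝ) → ∀ x : Fin p → ℝ, StrictMono x →
      (∀ i, |x i| ≤ R) → ∀ m m' : ℕ, ∀ a b a' b' : Fin p → ℕ, m + m' = 2 * n →
      |(m : ℝ) - 2 * n * t| ≤ 1 →
      (∀ i, (2 * a i : ℝ) = m + x i * √(2 * n)) → (∀ i, a i + b i + 1 = m + p) →
      (∀ i, (2 * a' i : ℝ) = m' + x i * √(2 * n)) → (∀ i, a' i + b' i + 1 = m' + p) →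
      ∃ δ : ℝ, |δ| ≤ C / √(n : ℝ) ∧
        starFormula p m (fun i => (a i : ℤ)) * starFormula p m' (fun i => (a' i : ℤ)) /
          starFormula p (2 * n) (fun i => (n : ℤ) + (i : ℕ)) =
        Real.exp δ * (((2 : ℝ) / n) ^ ((p : ℝ) / 2) * fHat p t x) := by
  obtain ⟨C, hC, S, hS, H⟩ := branch_factorials_expansion p t ht0 ht1 R hR
  refine ⟨p * C, by positivity, S, hS, ?_⟩
  intro n hn x hx hxR m m' a b a' b' hmm hmt ha hab ha' hab'
  have hs0 : 0 < √(n : ℝ) := by linarith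
  have hn0 : (0 : ℝ) < n := Real.sqrt_pos.mp hs0
  have hn1 : 0 < n := by exact_mod_cast hn0
  obtain ⟨hma, hVa⟩ := log_det_vandermonde_rescale hn1 hx ha
  obtain ⟨hma', hVa'⟩ := log_det_vandermonde_rescale hn1 hx ha'
  obtain ⟨hF1, hL1⟩ := log_starFormula hab hma
  obtain ⟨hF2, hL2⟩ := log_starFormula hab' hma'
  obtain ⟨hF3, hL3⟩ := log_starFormula (p := p) (m := 2 * n) (a := fun i => n + i)
    (b := fun i => n + (p - 1 - i)) (fun i => by have := i.2; omega) (fun i j hij => by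
      have : (i : ℕ) < j := hij
      simpa using this)
  have hdet : (Matrix.vandermonde fun i : Fin p => ((n + (i : ℕ) : ℕ) : ℝ)).det =
      (Matrix.vandermonde fun i : Fin p => ((i : ℕ) : ℝ)).det := by
    rw [← Matrix.det_vandermonde_add (fun i : Fin p => ((i : ℕ) : ℝ)) (n : ℝ)]
    congr 2
    ext i
    push_cast
    ring
  have hcast : (fun i : Fin p => ((n + (i : ℕ) : ℕ) : ℤ)) =
      fun i : Fin p => (n : ℤ) + (i : ℕ) := by
    ext i
    push_cast
    rfl
  rw [hcast] at hF3 hL3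
  rw [hdet] at hL3
  obtain ⟨hf, hLf⟩ := log_fHat hp ht0 ht1 hx
  have hT : 0 < ((2 : ℝ) / n) ^ ((p : ℝ) / 2) := by positivity
  set P := starFormula p m (fun i => (a i : ℤ)) * starFormula p m' (fun i => (a' i : ℤ)) /
          starFormula p (2 * n) (fun i => (n : ℤ) + (i : ℕ)) with hP
  have hP0 : 0 < P := by positivity
  refine ⟨Real.log P - Real.log (((2 : ℝ) / n) ^ ((p : ℝ) / 2) * fHat p t x), ?_, ?_⟩
  · rw [hP, Real.log_div (mul_pos hF1 hF2).ne' hF3.ne', Real.log_mul hF1.ne' hF2.ne',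
      Real.log_mul hT.ne' hf.ne', Real.log_rpow (by positivity), Real.log_div two_ne_zero hn0.ne',
      hL1, hL2, hL3, hVa, hVa', hLf]
    have hsum := Finset.abs_sum_le_sum_abs (fun i : Fin p =>
      (Real.log (m + i).factorial - Real.log (a i).factorial - Real.log (b i).factorial)
        + (Real.log (m' + i).factorial - Real.log (a' i).factorial - Real.log (b' i).factorial)
        - (Real.log (2 * n + i).factorial - Real.log (n + i).factorial
            - Real.log (n + (p - 1 - i)).factorial)
        - ((((i : ℕ) : ℝ) + 1 / 2 - p) * (Real.log t + Real.log (1 - t) + Real.log n)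
            + (((i : ℕ) : ℝ) + 1 / 2) * Real.log 2 - x i ^ 2 / (2 * t * (1 - t))
            - 1 / 2 * (Real.log 2 + Real.log Real.pi))) Finset.univ
    have hle := Finset.sum_le_card_nsmul Finset.univ _ (C / √(n : ℝ)) fun (i : Fin p) _ =>
      H n hn i i.2 (x i) (hxR i) m m' (a i) (b i) (a' i) (b' i) hmm hmt (ha i) (hab i)
        (ha' i) (hab' i)
    rw [Finset.card_univ, Fintype.card_fin, nsmul_eq_mul] at hle
    rw [mul_div_assoc (p : ℝ) C]
    refine le_trans (le_of_eq ?_) (hsum.trans hle)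
    congr 1
    simp only [Finset.sum_add_distrib, Finset.sum_sub_distrib, ← Finset.sum_mul, sum_fin_cast,
      Finset.sum_const, Finset.card_univ, Fintype.card_fin, nsmul_eq_mul]
    ring
  · rw [← Real.log_div hP0.ne' (mul_pos hT hf).ne', Real.exp_log (div_pos hP0 (mul_pos hT hf))]
    field_simp

/-- uniform local limit estimate on compact subsets of the open
chamber `{x_1 < ... < x_p}` for watermelons without wall condition. -/
theorem melonNW_local_limit (p : ℕ) (hp : 1 ≤ p) (t : ℝ) (ht0 : 0 < t) (ht1 : t < 1)
    (K : Set (Fin p → ℝ)) (hK : IsCompact K)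
    (hKsub : K ⊆ {x | StrictMono x}) :
    ∃ C > (0 : ℝ), ∃ n₀ : ℕ, ∀ n : ℕ, n₀ ≤ n → ∀ x ∈ K,
      (∀ i : Fin p, ∃ z : ℤ, (z : ℝ) = x i * Real.sqrt (2 * n) ∧
        (z - (⌊2 * (n : ℝ) * t⌋₊ : ℤ)) % 2 = 0) →
      |probNW p n (fun w => ∀ i, (w i ⌊2 * (n : ℝ) * t⌋₊ : ℝ) = x i * Real.sqrt (2 * n)) /
          (((2 : ℝ) / (n : ℝ)) ^ ((p : ℝ) / 2) * fHat p t x) - 1|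
        ≤ C / Real.sqrt n := by
  obtain ⟨R, hR0, hR⟩ : ∃ R ≥ (0 : ℝ), ∀ x ∈ K, ∀ i, |x i| ≤ R := by
    obtain ⟨R, hR⟩ := hK.isBounded.exists_norm_le
    exact ⟨max R 0, le_max_right _ _, fun x hx i =>
      (norm_le_pi_norm x i).trans ((hR x hx).trans (le_max_left _ _))⟩
  obtain ⟨C, hC, S, hS, H⟩ := log_starFormula_ratio hp ht0 ht1 hR0
  have ht1' : 0 < 1 - t := by linarith
  set S' := S + C + 1 + (R + 1) / t + (R + 1) / (1 - t) with hS'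
  have hdt : 0 < (R + 1) / t := by positivity
  have hdt' : 0 < (R + 1) / (1 - t) := by positivity
  refine ⟨2 * C, by positivity, ⌈S' ^ 2⌉₊, ?_⟩
  intro n hn x hx hz
  have hsS : S' ≤ √(n : ℝ) := Real.le_sqrt_of_sq_le (Nat.ceil_le.mp hn)
  set s := √(n : ℝ) with hs
  have hs0 : 0 < s := by linarith
  have hsn : s ^ 2 = n := Real.sq_sqrt (Nat.cast_nonneg n)
  have hmono : StrictMono x := hKsub hx
  set m := ⌊2 * (n : ℝ) * t⌋₊ with hm
  have hm1 : (m : ℝ) ≤ 2 * n * t := Nat.floor_le (by positivity)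
  have hm2 : 2 * n * t < (m : ℝ) + 1 := Nat.lt_floor_add_one _
  have hn0 : (0 : ℝ) ≤ n := Nat.cast_nonneg n
  have hmle : m ≤ 2 * n := by
    have : (m : ℝ) ≤ 2 * n := hm1.trans (by nlinarith)
    exact_mod_cast this
  obtain ⟨m', hmm⟩ : ∃ m', m + m' = 2 * n := ⟨2 * n - m, by omega⟩
  have hmmR : (m : ℝ) + m' = 2 * n := by exact_mod_cast hmm
  choose z hzx hzm using hz
  have hzabs : ∀ i, |(z i : ℝ)| ≤ 2 * R * s := by
    intro i
    rw [hzx, abs_mul, abs_of_nonneg (Real.sqrt_nonneg _), Real.sqrt_mul (by norm_num), ← hs]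
    have h2 : √(2 : ℝ) ≤ 2 := by
      rw [Real.sqrt_le_left (by norm_num)]; norm_num
    calc |x i| * (√2 * s) ≤ R * (2 * s) := by
          have := hR x hx i
          gcongr
      _ = _ := by ring
  have hlarge : ∀ c : ℝ, 0 < c → (R + 1) / c ≤ s → 2 * R * s + 1 ≤ 2 * n * c := by
    intro c hc hcs
    rw [div_le_iff₀ hc] at hcs
    rw [← hsn]
    nlinarith [mul_le_mul_of_nonneg_left hcs hs0.le]
  have hbig := hlarge t ht0 (by linarith)
  have hbig' := hlarge (1 - t) ht1' (by linarith)
  have hnonneg : ∀ i, -(m : ℤ) ≤ z i ∧ z i ≤ m ∧ -(m' : ℤ) ≤ z i ∧ z i ≤ m' := by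
    intro i
    obtain ⟨h1, h2⟩ := abs_le.mp (hzabs i)
    refine ⟨?_, ?_, ?_, ?_⟩
    all_goals
      rw [← Int.cast_le (R := ℝ)]
      push_cast
      linarith
  have hzmono : StrictMono z := fun i j hij => by
    rw [← Int.cast_lt (R := ℝ), hzx, hzx]
    have hs2 : 0 < √(2 * (n : ℝ)) := by
      rw [← hsn]; positivity
    exact mul_lt_mul_of_pos_right (hmono hij) hs2
  have key : ∀ M : ℕ, (∀ i, -(M : ℤ) ≤ z i ∧ z i ≤ M) → (∀ i, (z i - M) % 2 = 0) →
      ∃ a b : Fin p → ℕ, (∀ i, z i = 2 * (a i : ℤ) - M) ∧ ∀ i, a i + b i + 1 = M + p := by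
    intro M hM hpar
    refine ⟨fun i => ((z i + M) / 2).toNat, fun i => M + p - 1 - ((z i + M) / 2).toNat,
      fun i => ?_, fun i => ?_⟩
    · have h1 := hM i
      have h2 := hpar i
      dsimp only
      omega
    · have h1 := hM i
      dsimp only
      omega
  obtain ⟨a, b, ha, hab⟩ := key m (fun i => ⟨(hnonneg i).1, (hnonneg i).2.1⟩) hzm
  obtain ⟨a', b', ha', hab'⟩ := key m' (fun i => (hnonneg i).2.2) fun i => by
    have := hzm i
    omega
  have hareal : ∀ i, (2 * a i : ℝ) = m + x i * √(2 * n) := fun i => by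
    have : (z i : ℝ) = 2 * (a i : ℝ) - m := by exact_mod_cast congrArg (Int.cast (R := ℝ)) (ha i)
    rw [← hzx]
    linarith
  have hareal' : ∀ i, (2 * a' i : ℝ) = m' + x i * √(2 * n) := fun i => by
    have : (z i : ℝ) = 2 * (a' i : ℝ) - m' := by
      exact_mod_cast congrArg (Int.cast (R := ℝ)) (ha' i)
    rw [← hzx]
    linarith
  obtain ⟨δ, hδ, hexp⟩ := H n (by linarith) x hmono (hR x hx) m m' a b a' b' hmm
    (by rw [abs_le]; constructor <;> linarith) hareal hab hareal' hab'
  have hevent : (fun w : Fin p → ℕ → ℤ => ∀ i, (w i m : ℝ) = x i * √(2 * n)) =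
      fun w => ∀ i, w i m = z i := by
    ext w
    refine forall_congr' fun i => ?_
    rw [← hzx, Int.cast_inj]
  have hpos : 0 < ((2 : ℝ) / n) ^ ((p : ℝ) / 2) * fHat p t x := by
    have hn1 : (0 : ℝ) < n := by rw [← hsn]; positivity
    exact mul_pos (by positivity) (log_fHat hp ht0 ht1 hmono).1
  rw [hevent, probNW_eq hp hmm hzmono ha ha', hexp, mul_div_assoc, div_self hpos.ne', mul_one]
  have hδ1 : |δ| ≤ 1 := hδ.trans ((div_le_one hs0).mpr (by linarith))
  refine (Real.abs_exp_sub_one_le hδ1).trans ?_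
  rw [mul_div_assoc]
  linarith
end
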